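/- arXiv:1309.5862 — 12 statements merged into one kernel-verified Lean document; each statement's English description precedes it below -/
import Mathlib

section
/- For a bound function β, the following are equivalent: (a) for all bound functions β₁, β₂, β₁ ≤o β₂ implies β ∘ β₁ ≤o β ∘ β₂; (b) β is subhomogeneous. -/
open Filter

/-- A bound function (time bound): `n ≤ β n ≤ β (n+1)` for all `n`. -/
def IsBound (β : ℕ → ℕ) : Prop := ∀ n : ℕ, n ≤ β n ∧ β n ≤ β (n + 1)

/-- `f ≤ₐₑ g` : `f n ≤ g n` for all sufficiently large `n`. -/
def AEle (f g : ℕ → ℕ) : Prop := ∀ᶠ n in atTop, f n ≤ g n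

/-- `f ≤o g` : there is a constant `c ≥ 1` with `f ≤ₐₑ c·g`. -/
def LeO (f g : ℕ → ℕ) : Prop := ∃ c : ℕ, 1 ≤ c ∧ AEle f (fun n => c * g n)

/-- `f = o(g)` : `f n / g n → 0`. -/
def LittleO (f g : ℕ → ℕ) : Prop :=
  Tendsto (fun n => (f n : ℝ) / (g n : ℝ)) atTop (nhds 0)

/-- `β` is superlinear : `β n / n → ∞`. -/
def Superlinear (β : ℕ → ℕ) : Prop :=
  Tendsto (fun n => (β n : ℝ) / (n : ℝ)) atTop atTop

/-- A set of bounds is tame iff for any two members the sequence of quotients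
converges to a limit in `ℝ ∪ {∞}`. -/
def Tame (U : Set (ℕ → ℕ)) : Prop :=
  ∀ β₁ ∈ U, ∀ β₂ ∈ U,
    (∃ L : ℝ, Tendsto (fun n => (β₁ n : ℝ) / (β₂ n : ℝ)) atTop (nhds L)) ∨
      Tendsto (fun n => (β₁ n : ℝ) / (β₂ n : ℝ)) atTop atTop

/-- `B₁ ≤ₐₑ B₂` for sets of bounds. -/
def SetLeAE (B₁ B₂ : Set (ℕ → ℕ)) : Prop := ∀ β₁ ∈ B₁, ∃ β₂ ∈ B₂, AEle β₁ β₂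

/-- `B₁ ≡ₐₑ B₂` (confinality). -/
def SetEquivAE (B₁ B₂ : Set (ℕ → ℕ)) : Prop := SetLeAE B₁ B₂ ∧ SetLeAE B₂ B₁

/-- `B₁ ≤o B₂` for sets of bounds. -/
def SetLeO (B₁ B₂ : Set (ℕ → ℕ)) : Prop := ∀ β₁ ∈ B₁, ∃ β₂ ∈ B₂, LeO β₁ β₂

/-- `It β` : the set of `m`-fold iterates of `β`, `m ≥ 1`. -/
def It (β : ℕ → ℕ) : Set (ℕ → ℕ) := {g | ∃ m : ℕ, 1 ≤ m ∧ g = β^[m]}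

/-- `It B = ⋃_{β ∈ B} It β`. -/
def ItS (B : Set (ℕ → ℕ)) : Set (ℕ → ℕ) := ⋃ β ∈ B, It β

/-- `β₁ ≤it β₂` iff `It β₁ ≤ₐₑ It β₂`. -/
def LeIt (β₁ β₂ : ℕ → ℕ) : Prop := SetLeAE (It β₁) (It β₂)

/-- `β₁ <it β₂` iff `β₁ ≤it β₂` but not `β₂ ≤it β₁`. -/
def LtIt (β₁ β₂ : ℕ → ℕ) : Prop := LeIt β₁ β₂ ∧ ¬ LeIt β₂ β₁

/-- `α₁ ≤pow α₂` : for each `k` there is `l` with `α₁^k ≤ₐₑ α₂^l` (pointwise powers). -/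
def PowLe (α₁ α₂ : ℕ → ℕ) : Prop :=
  ∀ k : ℕ, ∃ l : ℕ, AEle (fun n => α₁ n ^ k) (fun n => α₂ n ^ l)

/-- `α₁ <pow α₂`. -/
def PowLt (α₁ α₂ : ℕ → ℕ) : Prop := PowLe α₁ α₂ ∧ ¬ PowLe α₂ α₁

/-- `α₁ ≪pow α₂` : `α₁^k ≤ₐₑ α₂` for every `k`. -/
def PowLL (α₁ α₂ : ℕ → ℕ) : Prop := ∀ k : ℕ, AEle (fun n => α₁ n ^ k) α₂

/-- f-consistency: to any `k` there is `l` with `α(n^k) ≤ (α n)^l` for almost all `n`. -/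
def FCons (α : ℕ → ℕ) : Prop := ∀ k : ℕ, ∃ l : ℕ, ∀ᶠ n in atTop, α (n ^ k) ≤ α n ^ l

/-- The paper's `log`: `⌈log₂ n⌉` for `n ≥ 2`, and `log 0 = log 1 = 1`. -/
def plog (n : ℕ) : ℕ := max 1 (Nat.clog 2 n)

/-- e-consistency: to any `k` there is `l` with `α(n^{(log n)^k}) ≤ (α n)^l` for almost all `n`. -/
def ECons (α : ℕ → ℕ) : Prop :=
  ∀ k : ℕ, ∃ l : ℕ, ∀ᶠ n in atTop, α (n ^ (plog n ^ k)) ≤ α n ^ l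

/-- The iterated logarithm `log* n = min {m ≥ 1 : log^⟨m⟩ n = 1}`. -/
noncomputable def logstar (n : ℕ) : ℕ := sInf {m : ℕ | 1 ≤ m ∧ plog^[m] n = 1}

/-- The set of linear bounds. -/
def Blin : Set (ℕ → ℕ) := {β | ∃ c : ℕ, 1 ≤ c ∧ β = fun n => c * n}

/-- Condition (ii) of regularity: for all `β, β' ∈ B` there is `β'' ∈ B` with
`β + β' ∘ β ≤ₐₑ β''`. -/
def CompCond (B : Set (ℕ → ℕ)) : Prop :=
  ∀ β ∈ B, ∀ β' ∈ B, ∃ β'' ∈ B, AEle (fun n => β n + β' (β n)) β''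

/-- Subhomogeneity: for every constant `c ≥ 1` there is `c̄` with
`β (c * n) ≤ c̄ * β n` for all `n ≥ 1`. -/
def Subhomogeneous (β : ℕ → ℕ) : Prop :=
  ∀ c : ℕ, 1 ≤ c → ∃ cbar : ℕ, ∀ n : ℕ, 1 ≤ n → β (c * n) ≤ cbar * β n

theorem stmt2 (β : ℕ → ℕ) (hβ : IsBound β) :
    (∀ β₁ β₂ : ℕ → ℕ, IsBound β₁ → IsBound β₂ → LeO β₁ β₂ → LeO (β ∘ β₁) (β ∘ β₂)) ↔
      Subhomogeneous β := by
  have mono : Monotone β := monotone_nat_of_le_succ fun n => (hβ n).2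
  constructor
  · intro h c hc
    have h1 : LeO (fun n => c * n) (fun n => n) :=
      ⟨c, hc, Eventually.of_forall fun n => le_refl _⟩
    obtain ⟨k, hk, hae⟩ := h (fun n => c * n) (fun n => n)
      (fun n => ⟨Nat.le_mul_of_pos_left n hc, Nat.mul_le_mul_left c (Nat.le_succ n)⟩)
      (fun n => ⟨le_refl _, Nat.le_succ n⟩) h1
    obtain ⟨N, hN⟩ := eventually_atTop.1 hae
    refine ⟨k + β (c * N), fun n hn => ?_⟩
    have hpos : 1 ≤ β n := hn.trans (hβ n).1
    rcases le_total N n with hle | hle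
    · have h2 : β (c * n) ≤ k * β n := hN n hle
      exact h2.trans (Nat.mul_le_mul_right _ (Nat.le_add_right _ _))
    · have h2 : β (c * n) ≤ β (c * N) := mono (Nat.mul_le_mul_left c hle)
      nlinarith [Nat.zero_le (k * β n), Nat.mul_le_mul_left (β (c * N)) hpos]
  · rintro h β₁ β₂ hb₁ hb₂ ⟨c, hc, hae⟩
    obtain ⟨d, hd⟩ := h c hc
    refine ⟨d + 1, Nat.le_add_left _ _, ?_⟩
    filter_upwards [hae, eventually_ge_atTop 1] with n hn hn1
    have h2 : β (β₁ n) ≤ d * β (β₂ n) :=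
      (mono hn).trans (hd _ (hn1.trans (hb₂ n).1))
    exact h2.trans (Nat.mul_le_mul_right _ (Nat.le_succ d))
end

section
/- Let U be a tame set of bound functions and let B₁, B₂ be nonempty subsets of U. Then B₁ ≤o B₂ or B₂ ≤o B₁. -/
open Filter

theorem leO_total_of_tame {U : Set (ℕ → ℕ)} (hU : ∀ β ∈ U, IsBound β) (hT : Tame U)
    {f g : ℕ → ℕ} (hf : f ∈ U) (hg : g ∈ U) : LeO f g ∨ LeO g f := by
  have pos : ∀ᶠ n : ℕ in atTop, (0 : ℝ) < (g n : ℝ) := by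
    filter_upwards [eventually_ge_atTop 1] with n hn
    have := (hU g hg n).1
    exact_mod_cast (by omega : 0 < g n)
  rcases hT f hf g hg with ⟨L, hL⟩ | h
  · left
    obtain ⟨c, hc⟩ := exists_nat_gt L
    refine ⟨c + 1, by omega, ?_⟩
    filter_upwards [pos, hL.eventually (gt_mem_nhds hc)] with n hp hn
    rw [div_lt_iff₀ hp] at hn
    have h2 : f n < c * g n := by exact_mod_cast hn
    show f n ≤ (c + 1) * g n
    nlinarith
  · right
    refine ⟨1, le_refl 1, ?_⟩
    filter_upwards [pos, h.eventually_ge_atTop 1] with n hp hn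
    rw [le_div_iff₀ hp] at hn
    have h2 : 1 * g n ≤ f n := by exact_mod_cast hn
    show g n ≤ 1 * f n
    omega

theorem stmt3 (U : Set (ℕ → ℕ)) (hU : ∀ β ∈ U, IsBound β) (hT : Tame U)
    (B₁ B₂ : Set (ℕ → ℕ)) (hB₁ : B₁ ⊆ U) (hB₂ : B₂ ⊆ U)
    (hne₁ : B₁.Nonempty) (hne₂ : B₂.Nonempty) :
    SetLeO B₁ B₂ ∨ SetLeO B₂ B₁ := by
  by_cases h : SetLeO B₁ B₂
  · exact Or.inl h
  · right
    unfold SetLeO at h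
    push Not at h
    obtain ⟨β₁, h₁, h⟩ := h
    intro β₂ h₂
    exact ⟨β₁, h₁, (leO_total_of_tame hU hT (hB₁ h₁) (hB₂ h₂)).resolve_left (h β₂ h₂)⟩
end

section
/- Let β be a bound function which is superlinear or ultimately linear. Then It(β) ∪ {id} is tame, where id is the identity function on ℕ. In the superlinear case one moreover has the strict chain id = o(β), and β^⟨k⟩ = o(β^⟨k+1⟩) for every k ≥ 1. -/
open Filter

/-- `β` is ultimately linear: `β n = c * n` for some `c ≥ 1` and almost all `n`. -/
def UltimatelyLinear (β : ℕ → ℕ) : Prop :=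
  ∃ c : ℕ, 1 ≤ c ∧ ∀ᶠ n in atTop, β n = c * n

theorem iter_ge_self (β : ℕ → ℕ) (hβ : IsBound β) (k n : ℕ) : n ≤ β^[k] n := by
  induction k with
  | zero => simp
  | succ k ih =>
    rw [Function.iterate_succ_apply']
    exact ih.trans (hβ _).1

theorem iter_tendsto (β : ℕ → ℕ) (hβ : IsBound β) (k : ℕ) : Tendsto β^[k] atTop atTop :=
  tendsto_atTop_mono (iter_ge_self β hβ k) tendsto_id

theorem super_iter (β : ℕ → ℕ) (hβ : IsBound β) (hs : Superlinear β) (d : ℕ) :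
    Superlinear β^[d + 1] := by
  refine tendsto_atTop_mono (fun n => ?_) hs
  have h1 : β n ≤ β^[d + 1] n := by
    rw [Function.iterate_succ_apply]
    exact iter_ge_self β hβ d _
  have h2 : (β n : ℝ) ≤ (β^[d + 1] n : ℝ) := by exact_mod_cast h1
  exact div_le_div_of_nonneg_right h2 (Nat.cast_nonneg n)

theorem super_ratio (β : ℕ → ℕ) (hβ : IsBound β) (hs : Superlinear β) (k d : ℕ) :
    Tendsto (fun n => (β^[k + (d + 1)] n : ℝ) / (β^[k] n : ℝ)) atTop atTop := by
  have h := (super_iter β hβ hs d).comp (iter_tendsto β hβ k)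
  refine h.congr (fun n => ?_)
  rw [add_comm k (d + 1), Function.iterate_add_apply]
  rfl

theorem super_littleO (β : ℕ → ℕ) (hβ : IsBound β) (hs : Superlinear β) (k d : ℕ) :
    LittleO β^[k] β^[k + (d + 1)] := by
  refine (super_ratio β hβ hs k d).inv_tendsto_atTop.congr (fun n => ?_)
  simp [inv_div]

theorem lin_iter (β : ℕ → ℕ) (hβ : IsBound β) (c : ℕ)
    (h : ∀ᶠ n in atTop, β n = c * n) (k : ℕ) : ∀ᶠ n in atTop, β^[k] n = c ^ k * n := by
  induction k with
  | zero => simp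
  | succ k ih =>
    filter_upwards [ih, (iter_tendsto β hβ k).eventually h] with n h1 h2
    rw [Function.iterate_succ_apply', h2, h1]
    ring

theorem iter_ratio_self (β : ℕ → ℕ) (hβ : IsBound β) (k : ℕ) :
    Tendsto (fun n => (β^[k] n : ℝ) / (β^[k] n : ℝ)) atTop (nhds 1) := by
  refine tendsto_const_nhds.congr' ?_
  filter_upwards [eventually_ge_atTop 1] with n hn
  have h1 := iter_ge_self β hβ k n
  have h2 : (β^[k] n : ℝ) ≠ 0 := by
    have : β^[k] n ≠ 0 := by omega
    exact_mod_cast this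
  rw [div_self h2]

theorem mem_iter (β g : ℕ → ℕ) (hg : g ∈ It β ∪ {(id : ℕ → ℕ)}) : ∃ k, g = β^[k] := by
  rcases hg with ⟨m, _, h⟩ | h
  · exact ⟨m, h⟩
  · exact ⟨0, h⟩

theorem stmt5 (β : ℕ → ℕ) (hβ : IsBound β)
    (h : Superlinear β ∨ UltimatelyLinear β) :
    Tame (It β ∪ {(id : ℕ → ℕ)}) ∧
      (Superlinear β →
        LittleO id β ∧ ∀ k : ℕ, 1 ≤ k → LittleO β^[k] β^[k + 1]) := by
  refine ⟨?_, fun hs => ⟨?_, fun k _ => super_littleO β hβ hs k 0⟩⟩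
  · intro f hf g hg
    obtain ⟨k, rfl⟩ := mem_iter β f hf
    obtain ⟨l, rfl⟩ := mem_iter β g hg
    rcases h with hs | ⟨c, hc, hl⟩
    · rcases lt_trichotomy k l with hkl | hkl | hkl
      · obtain ⟨d, rfl⟩ := Nat.exists_eq_add_of_lt hkl
        exact Or.inl ⟨0, super_littleO β hβ hs k d⟩
      · subst hkl
        exact Or.inl ⟨1, iter_ratio_self β hβ k⟩
      · obtain ⟨d, rfl⟩ := Nat.exists_eq_add_of_lt hkl
        exact Or.inr (super_ratio β hβ hs l d)
    · refine Or.inl ⟨(c : ℝ) ^ k / (c : ℝ) ^ l, tendsto_const_nhds.congr' ?_⟩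
      filter_upwards [lin_iter β hβ c hl k, lin_iter β hβ c hl l,
        eventually_ge_atTop 1] with n h1 h2 hn
      have hn' : (n : ℝ) ≠ 0 := by
        have : n ≠ 0 := by omega
        exact_mod_cast this
      rw [h1, h2]
      push_cast
      rw [mul_div_mul_right _ _ hn']
  · have h0 := super_littleO β hβ hs 0 0
    simpa using h0
end

section
/- Let β₁, β₂ be bound functions with β₁ ≤o β₂ and β₂ superlinear. Then β₁ ≤it β₂, i.e. It(β₁) ≤ₐₑ It(β₂). -/
open Filter

theorem stmt6 (β₁ β₂ : ℕ → ℕ) (h₁ : IsBound β₁) (h₂ : IsBound β₂)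
    (hle : LeO β₁ β₂) (hsl : Superlinear β₂) : LeIt β₁ β₂ := by
  obtain ⟨c, hc, hle⟩ := hle
  have hm : Monotone β₂ := monotone_nat_of_le_succ fun n => (h₂ n).2
  have h3 : ∀ᶠ n : ℕ in atTop, c * n ≤ β₂ n := by
    filter_upwards [hsl.eventually_ge_atTop (c : ℝ), eventually_gt_atTop 0] with n hn hpos
    have hp : (0 : ℝ) < n := by exact_mod_cast hpos
    rw [le_div_iff₀ hp] at hn
    exact_mod_cast hn
  obtain ⟨N, hN⟩ := eventually_atTop.1 (hle.and h3)
  have key : ∀ n, N ≤ n → β₁ n ≤ β₂^[2] n := by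
    intro n hn
    exact (hN n hn).1.trans (hN (β₂ n) (hn.trans (h₂ n).1)).2
  rintro g ⟨m, hm1, rfl⟩
  refine ⟨β₂^[2 * m], ⟨2 * m, by omega, rfl⟩, ?_⟩
  have main : ∀ n, N ≤ n → ∀ m, N ≤ β₁^[m] n ∧ β₁^[m] n ≤ (β₂^[2])^[m] n := by
    intro n hn m
    induction m with
    | zero => exact ⟨hn, le_rfl⟩
    | succ k ih =>
      rw [Function.iterate_succ_apply', Function.iterate_succ_apply']
      exact ⟨ih.1.trans (h₁ _).1, (key _ ih.1).trans (hm.iterate 2 ih.2)⟩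
  refine eventually_atTop.2 ⟨N, fun n hn => ?_⟩
  rw [Function.iterate_mul]
  exact (main n hn m).2
end

section
/- Let B be a set of bound functions such that Blin ≤ₐₑ B and B ∪ {id} is tame (id the identity on ℕ). Then B satisfies the composition condition (for all β, β' ∈ B there is β'' ∈ B with β + β'∘β ≤ₐₑ β'') if and only if {β∘β : β ∈ B} ≤ₐₑ B. -/
open Filter

theorem tame_dich {x y : ℕ → ℕ} (hy : ∀ n, n ≤ y n)
    (h : (∃ L : ℝ, Tendsto (fun n => (x n : ℝ) / (y n : ℝ)) atTop (nhds L)) ∨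
      Tendsto (fun n => (x n : ℝ) / (y n : ℝ)) atTop atTop) :
    (∃ c : ℕ, ∀ᶠ n in atTop, x n ≤ c * y n) ∨
      ∀ c : ℕ, ∀ᶠ n in atTop, c * y n ≤ x n := by
  rcases h with ⟨L, h⟩ | h
  · left
    obtain ⟨c, hc⟩ := exists_nat_gt L
    refine ⟨c, ?_⟩
    filter_upwards [h.eventually (gt_mem_nhds hc), eventually_gt_atTop 0] with n h1 h2
    have : (0 : ℝ) < y n := by exact_mod_cast lt_of_lt_of_le h2 (hy n)
    rw [div_lt_iff₀ this] at h1
    exact_mod_cast h1.le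
  · right
    intro c
    filter_upwards [h.eventually_ge_atTop (c : ℝ), eventually_gt_atTop 0] with n h1 h2
    have : (0 : ℝ) < y n := by exact_mod_cast lt_of_lt_of_le h2 (hy n)
    rw [le_div_iff₀ this] at h1
    exact_mod_cast h1

theorem super_case (B : Set (ℕ → ℕ)) (hB : ∀ β ∈ B, IsBound β)
    (h : SetLeAE {g | ∃ β ∈ B, g = β ∘ β} B) {β β' γ : ℕ → ℕ} (hγ : γ ∈ B)
    (hs : ∀ c : ℕ, ∀ᶠ n in atTop, c * n ≤ γ n)
    (h1 : ∃ c : ℕ, ∀ᶠ n in atTop, β n ≤ c * γ n)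
    (h2 : ∃ c : ℕ, ∀ᶠ n in atTop, β' n ≤ c * γ n) (hβ : IsBound β) :
    ∃ β'' ∈ B, AEle (fun n => β n + β' (β n)) β'' := by
  obtain ⟨c, hc⟩ := h1
  obtain ⟨d, hd⟩ := h2
  obtain ⟨γ1, hγ1, e1⟩ := h _ ⟨γ, hγ, rfl⟩
  obtain ⟨γ2, hγ2, e2⟩ := h _ ⟨γ1, hγ1, rfl⟩
  have m : Monotone γ := monotone_nat_of_le_succ fun n => (hB γ hγ n).2
  have m1 : Monotone γ1 := monotone_nat_of_le_succ fun n => (hB γ1 hγ1 n).2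
  have g : ∀ n, n ≤ γ n := fun n => (hB γ hγ n).1
  have tγ : Tendsto γ atTop atTop := tendsto_atTop_mono g tendsto_id
  have tβ : Tendsto β atTop atTop := tendsto_atTop_mono (fun n => (hβ n).1) tendsto_id
  have tγγ := tγ.comp tγ
  refine ⟨γ2, hγ2, ?_⟩
  unfold AEle at e1 e2 ⊢
  filter_upwards [hc, tβ.eventually hd, e1, tγγ.eventually e1, e2, tγ.eventually (hs c),
    (tγ.comp tγγ).eventually (hs (c + d))] with n a1 a2 a3 a4 a5 a6 a7
  simp only [Function.comp_apply] at *
  have b1 : β n ≤ γ (γ n) := a1.trans a6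
  have b2 : γ (β n) ≤ γ (γ (γ n)) := m b1
  have b3 : γ n ≤ γ (γ (γ n)) := (g _).trans (g _)
  have b4 : γ1 (γ (γ n)) ≤ γ1 (γ1 n) := m1 a3
  have b5 := Nat.mul_le_mul_left d b2
  have b6 := Nat.mul_le_mul_left c b3
  have b7 := Nat.add_mul c d (γ (γ (γ n)))
  omega

theorem stmt7 (B : Set (ℕ → ℕ)) (hB : ∀ β ∈ B, IsBound β)
    (hlin : SetLeAE Blin B) (ht : Tame (B ∪ {(id : ℕ → ℕ)})) :
    CompCond B ↔ SetLeAE {g | ∃ β ∈ B, g = β ∘ β} B := by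
  constructor
  · rintro h _ ⟨β, hβ, rfl⟩
    obtain ⟨γ, hγ, e⟩ := h β hβ β hβ
    refine ⟨γ, hγ, ?_⟩
    unfold AEle at e ⊢
    filter_upwards [e] with n hn
    exact (Nat.le_add_left _ _).trans hn
  · intro h β hβ β' hβ'
    have dl : ∀ x ∈ B, _ := fun x hx =>
      tame_dich (x := x) (y := id) (fun n => le_rfl) (ht x (Or.inl hx) id (Or.inr rfl))
    have dd := tame_dich (x := β) (y := β') (fun n => (hB β' hβ' n).1)
      (ht β (Or.inl hβ) β' (Or.inl hβ'))
    have self : ∀ x : ℕ → ℕ, ∃ c : ℕ, ∀ᶠ n in atTop, x n ≤ c * x n :=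
      fun x => ⟨1, Eventually.of_forall fun n => by simp⟩
    have lin : ∀ x ∈ B, ∀ y ∈ B, (∃ c : ℕ, ∀ᶠ n in atTop, x n ≤ c * id n) →
        ∃ c : ℕ, ∀ᶠ n in atTop, x n ≤ c * y n := by
      rintro x hx y hy ⟨c, hc⟩
      refine ⟨c, ?_⟩
      filter_upwards [hc] with n hn
      exact hn.trans (Nat.mul_le_mul_left c (hB y hy n).1)
    rcases dl β hβ with l | s <;> rcases dl β' hβ' with l' | s'
    · obtain ⟨c, hc⟩ := l
      obtain ⟨d, hd⟩ := l'
      obtain ⟨γ, hγ, e⟩ := hlin (fun n => (c + d * c + 1) * n) ⟨_, by omega, rfl⟩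
      refine ⟨γ, hγ, ?_⟩
      have tβ : Tendsto β atTop atTop :=
        tendsto_atTop_mono (fun n => (hB β hβ n).1) tendsto_id
      unfold AEle at e ⊢
      filter_upwards [hc, tβ.eventually hd, e] with n a1 a2 a3
      simp only [id] at a1 a2
      have := Nat.mul_le_mul_left d a1
      nlinarith
    · exact super_case B hB h hβ' s' (lin β hβ β' hβ' l) (self _) (hB β hβ)
    · exact super_case B hB h hβ s (self _) (lin β' hβ' β hβ l') (hB β hβ)
    · rcases dd with q | q
      · exact super_case B hB h hβ' s' q (self _) (hB β hβ)
      · exact super_case B hB h hβ s (self _) ⟨1, by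
          filter_upwards [q 1] with n hn
          omega⟩ (hB β hβ)
end

section
/- Let B be a set of bound functions such that Blin ≤ₐₑ B and B ∪ {id} is tame (id the identity on ℕ). Then B satisfies the composition condition (for all β, β' ∈ B there is β'' ∈ B with β + β'∘β ≤ₐₑ β'') if and only if It(B) ≤ₐₑ B, where It(B) = ⋃_{β ∈ B} It(β). -/
open Filter

theorem aux_cmp (f g : ℕ → ℕ) (hg : IsBound g)
    (h : (∃ L : ℝ, Tendsto (fun n => (f n : ℝ) / (g n : ℝ)) atTop (nhds L)) ∨
      Tendsto (fun n => (f n : ℝ) / (g n : ℝ)) atTop atTop) :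
    (∃ c : ℕ, 1 ≤ c ∧ ∀ᶠ n in atTop, f n ≤ c * g n) ∨
      (∀ c : ℕ, ∀ᶠ n in atTop, c * g n ≤ f n) := by
  rcases h with ⟨L, hL⟩ | h
  · left
    obtain ⟨c, hc⟩ := exists_nat_gt (max L 1)
    refine ⟨c, ?_, ?_⟩
    · have h1 : (1 : ℝ) < c := lt_of_le_of_lt (le_max_right _ _) hc
      exact_mod_cast h1.le
    · filter_upwards [hL.eventually_lt_const (lt_of_le_of_lt (le_max_left _ _) hc),
        eventually_ge_atTop 1] with n hn h1
      have hp : (0 : ℝ) < g n := by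
        have := (hg n).1
        exact_mod_cast (by omega : 0 < g n)
      rw [div_lt_iff₀ hp] at hn
      exact_mod_cast hn.le
  · right
    intro c
    filter_upwards [h.eventually_ge_atTop (c : ℝ), eventually_ge_atTop 1] with n hn h1
    have hp : (0 : ℝ) < g n := by
      have := (hg n).1
      exact_mod_cast (by omega : 0 < g n)
    rw [le_div_iff₀ hp] at hn
    exact_mod_cast hn

theorem aux_mono {f : ℕ → ℕ} (h : IsBound f) : Monotone f :=
  monotone_nat_of_le_succ fun n => (h n).2

theorem aux_tend {f : ℕ → ℕ} (h : IsBound f) : Tendsto f atTop atTop :=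
  tendsto_atTop_mono (fun n => (h n).1) tendsto_id

theorem aux_max (B : Set (ℕ → ℕ)) (hB : ∀ β ∈ B, IsBound β)
    (ht : Tame (B ∪ {(id : ℕ → ℕ)})) (f g : ℕ → ℕ) (hf : f ∈ B) (hg : g ∈ B) :
    ∃ γ ∈ B, ∃ c : ℕ, (∀ᶠ n in atTop, f n ≤ c * γ n) ∧ (∀ᶠ n in atTop, g n ≤ c * γ n) := by
  rcases aux_cmp f g (hB g hg) (ht f (Or.inl hf) g (Or.inl hg)) with ⟨c, hc, h⟩ | h
  · exact ⟨g, hg, c, h, Eventually.of_forall fun n => Nat.le_mul_of_pos_left _ hc⟩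
  · refine ⟨f, hf, 1, Eventually.of_forall fun n => by simp, ?_⟩
    filter_upwards [h 1] with n hn
    simpa using hn

theorem stmt8 (B : Set (ℕ → ℕ)) (hB : ∀ β ∈ B, IsBound β)
    (hlin : SetLeAE Blin B) (ht : Tame (B ∪ {(id : ℕ → ℕ)})) :
    CompCond B ↔ SetLeAE (ItS B) B := by
  constructor
  · intro hC g hg
    simp only [ItS, Set.mem_iUnion] at hg
    obtain ⟨β, hβ, m, hm, rfl⟩ := hg
    induction m, hm using Nat.le_induction with
    | base => exact ⟨β, hβ, Eventually.of_forall fun n => by simp⟩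
    | succ m hm ih =>
      obtain ⟨γ, hγ, h⟩ := ih
      obtain ⟨δ, hδ, h'⟩ := hC β hβ γ hγ
      refine ⟨δ, hδ, ?_⟩
      filter_upwards [h', (aux_tend (hB β hβ)).eventually h] with n h1 h2
      rw [Function.iterate_succ_apply]
      omega
  · intro hI f hf g hg
    obtain ⟨γ, hγ, c, hfc, hgc⟩ := aux_max B hB ht f g hf hg
    have hft := aux_tend (hB f hf)
    have hγt := aux_tend (hB γ hγ)
    have hγm := aux_mono (hB γ hγ)
    have hgm := aux_mono (hB g hg)
    rcases aux_cmp γ id (fun n => ⟨le_rfl, Nat.le_succ n⟩)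
        (ht γ (Or.inl hγ) id (Or.inr rfl)) with ⟨C, hC, h⟩ | h
    · obtain ⟨δ, hδ, hd⟩ := hlin (fun n => (2 * (c * C) * (c * C) + 1) * n)
        ⟨_, Nat.le_add_left _ _, rfl⟩
      refine ⟨δ, hδ, ?_⟩
      filter_upwards [hd, hfc, h, hft.eventually hgc, hft.eventually h] with n h1 h2 h3 h4 h5
      simp only [id] at h3 h5
      have h6 := (hB g hg (f n)).1
      have h7 : g (f n) ≤ (c * C) * ((c * C) * n) :=
        calc g (f n) ≤ c * γ (f n) := h4
          _ ≤ c * (C * f n) := by gcongr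
          _ ≤ c * (C * (c * (C * n))) := by
            gcongr
            exact h2.trans (by gcongr)
          _ = _ := by ring
      refine le_trans ?_ h1
      nlinarith
    · obtain ⟨δ, hδ, hd⟩ := hI (γ^[5])
        (by simp only [ItS, Set.mem_iUnion]; exact ⟨γ, hγ, 5, by norm_num, rfl⟩)
      refine ⟨δ, hδ, ?_⟩
      have k1 := hγt.eventually (h c)
      have k2 := (hγt.comp (hγt.comp hγt)).eventually (h c)
      have k3 := (hγt.comp (hγt.comp (hγt.comp hγt))).eventually (h 2)
      filter_upwards [hd, hfc, hft.eventually hgc, hft.eventually (hγt.eventually (h c)), k1, k3]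
        with n h1 h2 h3 h4 h5 h6
      simp only [id, Function.comp] at h4 h5 h6
      have e1 : f n ≤ γ (γ n) := h2.trans h5
      have e2 : g (f n) ≤ γ (γ (γ (γ n))) := (h3.trans h4).trans (hγm (hγm e1))
      have e3 := (hB g hg (f n)).1
      refine le_trans ?_ h1
      change _ ≤ γ (γ (γ (γ (γ n))))
      omega
end

section
/- Let β(n) = n·α(n) with a nondecreasing, f-consistent function α : ℕ → ℕ such that 1 ≤ₐₑ α(n) and α(n) ≤ₐₑ n. Then It(β) ≡ₐₑ {n ↦ n·(α(n))^k : k ≥ 1}. Moreover, if β_i(n) = n·α_i(n) for i = 1, 2 with nondecreasing, f-consistent α_i satisfying 1 ≤ₐₑ α_i(n) ≤ₐₑ n, then β₁ ≤it β₂ iff α₁ ≤pow α₂, β₁ <it β₂ iff α₁ <pow α₂, and from 2 ≤ₐₑ α₁ and α₁ ≪pow α₂ it follows that β₁ <it β₂. -/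
open Filter

theorem aux_upper (α : ℕ → ℕ) (hm : Monotone α) (hf : FCons α)
    (h1 : AEle (fun _ => 1) α) (h2 : AEle α (fun n => n)) (m : ℕ) :
    ∃ k : ℕ, 1 ≤ k ∧ AEle ((fun n => n * α n)^[m]) (fun n => n * α n ^ k) := by
  induction m with
  | zero =>
    refine ⟨1, le_rfl, ?_⟩
    unfold AEle at *
    filter_upwards [h1] with n hn
    simpa using Nat.le_mul_of_pos_right n hn
  | succ m ih =>
    obtain ⟨k, hk, h⟩ := ih
    obtain ⟨l, hl⟩ := hf (k + 1)
    refine ⟨k + l, by omega, ?_⟩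
    unfold AEle at *
    filter_upwards [h, hl, h2] with n hn hln h2n
    rw [Function.iterate_succ_apply']
    have hX : ((fun n => n * α n)^[m]) n ≤ n ^ (k + 1) := by
      calc _ ≤ n * α n ^ k := hn
        _ ≤ n * n ^ k := Nat.mul_le_mul_left _ (Nat.pow_le_pow_left h2n k)
        _ = n ^ (k + 1) := by ring
    calc _ ≤ (n * α n ^ k) * α n ^ l := Nat.mul_le_mul hn ((hm hX).trans hln)
      _ = n * α n ^ (k + l) := by ring

theorem aux_lower (α : ℕ → ℕ) (hm : Monotone α)
    (h1 : AEle (fun _ => 1) α) (k : ℕ) :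
    AEle (fun n => n * α n ^ k) ((fun n => n * α n)^[k]) := by
  unfold AEle at *
  filter_upwards [h1] with n hn
  induction k with
  | zero => simp
  | succ k ih =>
    rw [Function.iterate_succ_apply']
    have hX : n ≤ ((fun n => n * α n)^[k]) n :=
      (Nat.le_mul_of_pos_right n (pow_pos hn k)).trans ih
    calc n * α n ^ (k + 1) = (n * α n ^ k) * α n := by ring
      _ ≤ _ := Nat.mul_le_mul ih (hm hX)

theorem aux_iff (α₁ α₂ : ℕ → ℕ) (m₁ : Monotone α₁) (m₂ : Monotone α₂) (f₁ : FCons α₁)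
    (f₂ : FCons α₂) (a₁ : AEle (fun _ => 1) α₁) (b₁ : AEle α₁ (fun n => n))
    (a₂ : AEle (fun _ => 1) α₂) (b₂ : AEle α₂ (fun n => n)) :
    LeIt (fun n => n * α₁ n) (fun n => n * α₂ n) ↔ PowLe α₁ α₂ := by
  constructor
  · intro h k
    rcases Nat.eq_zero_or_pos k with rfl | hk
    · exact ⟨0, by simp [AEle]⟩
    obtain ⟨g, ⟨m, -, rfl⟩, hg⟩ := h _ ⟨k, hk, rfl⟩
    obtain ⟨l, -, hl⟩ := aux_upper α₂ m₂ f₂ a₂ b₂ m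
    have hlow := aux_lower α₁ m₁ a₁ k
    refine ⟨l, ?_⟩
    unfold AEle at *
    filter_upwards [hg, hl, hlow, eventually_gt_atTop 0] with n h1 h2 h3 hn
    exact Nat.le_of_mul_le_mul_left (h3.trans (h1.trans h2)) hn
  · rintro h _ ⟨m, -, rfl⟩
    obtain ⟨k, -, hk⟩ := aux_upper α₁ m₁ f₁ a₁ b₁ m
    obtain ⟨l, hl⟩ := h k
    refine ⟨_, ⟨l + 1, by omega, rfl⟩, ?_⟩
    have hlow := aux_lower α₂ m₂ a₂ (l + 1)
    unfold AEle at *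
    filter_upwards [hk, hl, hlow, a₂] with n h1 h2 h3 h4
    refine h1.trans (le_trans ?_ h3)
    exact Nat.mul_le_mul_left _ (h2.trans (Nat.pow_le_pow_right h4 (by omega)))

theorem stmt10 :
    (∀ α : ℕ → ℕ, Monotone α → FCons α →
      AEle (fun _ => 1) α → AEle α (fun n => n) →
      SetEquivAE (It (fun n => n * α n)) {g | ∃ k : ℕ, 1 ≤ k ∧ g = fun n => n * α n ^ k}) ∧
    (∀ α₁ α₂ : ℕ → ℕ, Monotone α₁ → Monotone α₂ → FCons α₁ → FCons α₂ →
      AEle (fun _ => 1) α₁ → AEle α₁ (fun n => n) →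
      AEle (fun _ => 1) α₂ → AEle α₂ (fun n => n) →
      ((LeIt (fun n => n * α₁ n) (fun n => n * α₂ n) ↔ PowLe α₁ α₂) ∧
       (LtIt (fun n => n * α₁ n) (fun n => n * α₂ n) ↔ PowLt α₁ α₂) ∧
       (AEle (fun _ => 2) α₁ → PowLL α₁ α₂ →
         LtIt (fun n => n * α₁ n) (fun n => n * α₂ n)))) := by
  refine ⟨?_, ?_⟩
  · intro α hm hf h1 h2
    constructor
    · rintro _ ⟨m, -, rfl⟩
      obtain ⟨k, hk, h⟩ := aux_upper α hm hf h1 h2 m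
      exact ⟨_, ⟨k, hk, rfl⟩, h⟩
    · rintro _ ⟨k, hk, rfl⟩
      exact ⟨_, ⟨k, hk, rfl⟩, aux_lower α hm h1 k⟩
  · intro α₁ α₂ m₁ m₂ f₁ f₂ a₁ b₁ a₂ b₂
    have e₁ := aux_iff α₁ α₂ m₁ m₂ f₁ f₂ a₁ b₁ a₂ b₂
    have e₂ := aux_iff α₂ α₁ m₂ m₁ f₂ f₁ a₂ b₂ a₁ b₁
    have e₃ : LtIt (fun n => n * α₁ n) (fun n => n * α₂ n) ↔ PowLt α₁ α₂ :=
      and_congr e₁ (not_congr e₂)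
    refine ⟨e₁, e₃, fun h2 hll => e₃.2 ⟨fun k => ⟨1, by simpa using hll k⟩, fun hle => ?_⟩⟩
    obtain ⟨l, hl⟩ := hle 1
    have hll' := hll (l + 1)
    unfold AEle at *
    obtain ⟨n, h3, h4, h5⟩ := (h2.and (hl.and hll')).exists
    have h6 : α₁ n ^ (l + 1) ≤ α₁ n ^ l := h5.trans (by simpa using h4)
    exact absurd h6 (not_le.2 (Nat.pow_lt_pow_right h3 (Nat.lt_succ_self l)))
end

section
/- Let α₁ and α₂ be nondecreasing, f-consistent functions ℕ → ℕ with 1 ≤ₐₑ α_i(n) and α_i(n) ≤ₐₑ n for i = 1, 2. Then the function α defined by α(n) = 2^{msqrt( mlog(α₁(n)) · mlog(α₂(n)) )} is also nondecreasing, f-consistent, and satisfies 1 ≤ₐₑ α(n) and α(n) ≤ₐₑ n. -/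
open Filter

theorem stmt11_log_aux (a b l : ℕ) (h : b ≤ a ^ l) : Nat.log 2 b ≤ 2 * l * Nat.log 2 a := by
  rcases Nat.lt_or_ge a 2 with ha | ha
  · have hb : b ≤ 1 := h.trans (pow_le_one₀ (Nat.zero_le _) (by omega))
    have : Nat.log 2 b = 0 := Nat.log_of_lt (by omega)
    omega
  · have h1 : 1 ≤ Nat.log 2 a := Nat.log_pos (by norm_num) ha
    have h2 : a ≤ 2 ^ (Nat.log 2 a + 1) := (Nat.lt_pow_succ_log_self (by norm_num) a).le
    have h3 : b ≤ 2 ^ ((Nat.log 2 a + 1) * l) := by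
      rw [pow_mul]
      exact h.trans (Nat.pow_le_pow_left h2 l)
    have h4 : Nat.log 2 b ≤ (Nat.log 2 a + 1) * l := by
      have := Nat.log_mono_right (b := 2) h3
      rwa [Nat.log_pow (by norm_num)] at this
    nlinarith

theorem stmt11_sqrt_aux (M x : ℕ) : Nat.sqrt (M * x) ≤ 2 * M * Nat.sqrt x := by
  have h1 : x < (Nat.sqrt x + 1) * (Nat.sqrt x + 1) := Nat.lt_succ_sqrt x
  have h2 : x ≤ 4 * (Nat.sqrt x * Nat.sqrt x) := by
    rcases Nat.eq_zero_or_pos (Nat.sqrt x) with h | h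
    · rw [h] at h1; omega
    · nlinarith
  have h3 : M * x ≤ (2 * M * Nat.sqrt x) * (2 * M * Nat.sqrt x) := by
    have : M ≤ M * M := Nat.le_mul_self M
    calc M * x ≤ (M * M) * (4 * (Nat.sqrt x * Nat.sqrt x)) := Nat.mul_le_mul this h2
      _ = _ := by ring
  calc Nat.sqrt (M * x) ≤ _ := Nat.sqrt_le_sqrt h3
    _ = _ := Nat.sqrt_eq _

theorem stmt11 (α₁ α₂ : ℕ → ℕ) (hm₁ : Monotone α₁) (hm₂ : Monotone α₂)
    (hf₁ : FCons α₁) (hf₂ : FCons α₂)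
    (h1₁ : AEle (fun _ => 1) α₁) (hn₁ : AEle α₁ (fun n => n))
    (h1₂ : AEle (fun _ => 1) α₂) (hn₂ : AEle α₂ (fun n => n)) :
    Monotone (fun n => 2 ^ Nat.sqrt (Nat.log 2 (α₁ n) * Nat.log 2 (α₂ n))) ∧
    FCons (fun n => 2 ^ Nat.sqrt (Nat.log 2 (α₁ n) * Nat.log 2 (α₂ n))) ∧
    AEle (fun _ => 1) (fun n => 2 ^ Nat.sqrt (Nat.log 2 (α₁ n) * Nat.log 2 (α₂ n))) ∧
    AEle (fun n => 2 ^ Nat.sqrt (Nat.log 2 (α₁ n) * Nat.log 2 (α₂ n))) (fun n => n) := by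
  refine ⟨?_, ?_, ?_, ?_⟩
  · intro m n h
    exact Nat.pow_le_pow_right (by norm_num) (Nat.sqrt_le_sqrt (Nat.mul_le_mul
      (Nat.log_mono_right (hm₁ h)) (Nat.log_mono_right (hm₂ h))))
  · intro k
    obtain ⟨l₁, h₁⟩ := hf₁ k
    obtain ⟨l₂, h₂⟩ := hf₂ k
    refine ⟨2 * (2 * l₁ * (2 * l₂)), ?_⟩
    filter_upwards [h₁, h₂] with n e₁ e₂
    rw [← pow_mul]
    refine Nat.pow_le_pow_right (by norm_num) ?_
    have e := Nat.mul_le_mul (stmt11_log_aux _ _ _ e₁) (stmt11_log_aux _ _ _ e₂)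
    refine (Nat.sqrt_le_sqrt e).trans ?_
    rw [mul_mul_mul_comm, mul_comm (Nat.sqrt _)]
    exact stmt11_sqrt_aux _ _
  · exact Eventually.of_forall fun n => Nat.one_le_two_pow
  · filter_upwards [hn₁, hn₂, eventually_ge_atTop 1] with n e₁ e₂ hn
    have e := Nat.sqrt_le_sqrt (Nat.mul_le_mul (Nat.log_mono_right (b := 2) e₁)
      (Nat.log_mono_right (b := 2) e₂))
    rw [Nat.sqrt_eq] at e
    exact (Nat.pow_le_pow_right (by norm_num) e).trans (Nat.pow_log_le_self 2 (by omega))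
end

section
/- Let α₁ and α₂ be nondecreasing functions ℕ → ℕ with 1 ≤ₐₑ α_i(n) and α_i(n) ≤ₐₑ n for i = 1, 2, and let α(n) = 2^{msqrt( mlog(α₁(n)) · mlog(α₂(n)) )}. If 2 ≤ₐₑ α₁ and α₁ ≤pow α₂, then α₁ ≤pow α and α ≤pow α₂. If moreover α₁ <pow α₂, then α₁ <pow α and α <pow α₂. If 2 ≤ₐₑ α₁ and α₁ ≪pow α₂, then α₁ ≪pow α and α ≪pow α₂. -/
open Filter

lemma lg_bd {x : ℕ} (h : 2 ≤ x) :
    1 ≤ Nat.log 2 x ∧ 2 ^ Nat.log 2 x ≤ x ∧ x < 2 ^ (Nat.log 2 x + 1) ∧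
      x ≤ 2 ^ (2 * Nat.log 2 x) := by
  have h1 : 1 ≤ Nat.log 2 x := Nat.log_pos (by norm_num) h
  have h3 : x < 2 ^ (Nat.log 2 x + 1) := Nat.lt_pow_succ_log_self (by norm_num) x
  refine ⟨h1, Nat.pow_log_le_self 2 (by omega), h3, h3.le.trans ?_⟩
  exact Nat.pow_le_pow_right (by norm_num) (by omega)

lemma powLe_iff {f g : ℕ → ℕ} (hf : AEle (fun _ => 2) f) (hg : AEle (fun _ => 2) g) :
    PowLe f g ↔ ∃ c : ℕ, 1 ≤ c ∧ ∀ᶠ n in atTop, Nat.log 2 (f n) ≤ c * Nat.log 2 (g n) := by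
  constructor
  · intro h
    obtain ⟨l, hl⟩ := h 1
    refine ⟨2 * l + 1, by omega, ?_⟩
    filter_upwards [hf, hg, hl] with n h1 h2 h3
    obtain ⟨a1, a2, a3, a4⟩ := lg_bd h1
    obtain ⟨b1, b2, b3, b4⟩ := lg_bd h2
    have h5 : 2 ^ Nat.log 2 (f n) ≤ 2 ^ (2 * Nat.log 2 (g n) * l) := by
      rw [pow_mul 2 (2 * Nat.log 2 (g n))]
      calc 2 ^ Nat.log 2 (f n) ≤ f n := a2
        _ ≤ g n ^ l := by simpa using h3
        _ ≤ _ := Nat.pow_le_pow_left b4 l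
    have := (Nat.pow_le_pow_iff_right (by norm_num : 1 < 2)).1 h5
    nlinarith
  · rintro ⟨c, -, hc⟩ k
    refine ⟨2 * c * k, ?_⟩
    filter_upwards [hf, hg, hc] with n h1 h2 h3
    obtain ⟨a1, a2, a3, a4⟩ := lg_bd h1
    obtain ⟨b1, b2, b3, b4⟩ := lg_bd h2
    calc f n ^ k ≤ (2 ^ (2 * Nat.log 2 (f n))) ^ k := Nat.pow_le_pow_left a4 k
      _ ≤ (2 ^ (Nat.log 2 (g n) * (2 * c))) ^ k := by
        apply Nat.pow_le_pow_left
        apply Nat.pow_le_pow_right (by norm_num)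
        nlinarith
      _ = (2 ^ Nat.log 2 (g n)) ^ (2 * c * k) := by
        rw [pow_mul 2 (Nat.log 2 (g n)), ← pow_mul _ (2 * c)]
      _ ≤ _ := Nat.pow_le_pow_left b2 _

lemma powLL_iff {f g : ℕ → ℕ} (hf : AEle (fun _ => 2) f) (hg : AEle (fun _ => 2) g) :
    PowLL f g ↔ ∀ k : ℕ, ∀ᶠ n in atTop, k * Nat.log 2 (f n) ≤ Nat.log 2 (g n) := by
  constructor
  · intro h k
    filter_upwards [hf, hg, h k] with n h1 h2 h3
    obtain ⟨a1, a2, a3, a4⟩ := lg_bd h1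
    obtain ⟨b1, b2, b3, b4⟩ := lg_bd h2
    have h5 : 2 ^ (Nat.log 2 (f n) * k) < 2 ^ (Nat.log 2 (g n) + 1) := by
      rw [pow_mul]
      exact ((Nat.pow_le_pow_left a2 k).trans h3).trans_lt b3
    have := (Nat.pow_lt_pow_iff_right (by norm_num : 1 < 2)).1 h5
    nlinarith
  · intro h k
    filter_upwards [hf, hg, h (2 * k)] with n h1 h2 h3
    obtain ⟨a1, a2, a3, a4⟩ := lg_bd h1
    obtain ⟨b1, b2, b3, b4⟩ := lg_bd h2
    calc f n ^ k ≤ (2 ^ (2 * Nat.log 2 (f n))) ^ k := Nat.pow_le_pow_left a4 k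
      _ = 2 ^ (2 * Nat.log 2 (f n) * k) := (pow_mul _ _ _).symm
      _ ≤ 2 ^ Nat.log 2 (g n) := Nat.pow_le_pow_right (by norm_num) (by nlinarith)
      _ ≤ _ := b2

lemma sq_bd {a b : ℕ} (ha : 1 ≤ a) (hb : 1 ≤ b) :
    1 ≤ Nat.sqrt (a * b) ∧ Nat.sqrt (a * b) ^ 2 ≤ a * b ∧
      a * b ≤ 4 * Nat.sqrt (a * b) ^ 2 := by
  have h1 : 1 ≤ Nat.sqrt (a * b) := Nat.sqrt_pos.2 (by positivity)
  have h2 := Nat.sqrt_le' (a * b)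
  have h3 := Nat.lt_succ_sqrt' (a * b)
  refine ⟨h1, h2, ?_⟩
  simp only [Nat.succ_eq_add_one] at h3
  nlinarith

lemma le_of_sq {x y : ℕ} (h : x ^ 2 ≤ y ^ 2) : x ≤ y :=
  (Nat.pow_le_pow_iff_left (by norm_num)).1 h

theorem stmt12 (α₁ α₂ : ℕ → ℕ) (hm₁ : Monotone α₁) (hm₂ : Monotone α₂)
    (h1₁ : AEle (fun _ => 1) α₁) (hn₁ : AEle α₁ (fun n => n))
    (h1₂ : AEle (fun _ => 1) α₂) (hn₂ : AEle α₂ (fun n => n)) :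
    (AEle (fun _ => 2) α₁ → PowLe α₁ α₂ →
      PowLe α₁ (fun n => 2 ^ Nat.sqrt (Nat.log 2 (α₁ n) * Nat.log 2 (α₂ n))) ∧
      PowLe (fun n => 2 ^ Nat.sqrt (Nat.log 2 (α₁ n) * Nat.log 2 (α₂ n))) α₂) ∧
    (AEle (fun _ => 2) α₁ → PowLt α₁ α₂ →
      PowLt α₁ (fun n => 2 ^ Nat.sqrt (Nat.log 2 (α₁ n) * Nat.log 2 (α₂ n))) ∧
      PowLt (fun n => 2 ^ Nat.sqrt (Nat.log 2 (α₁ n) * Nat.log 2 (α₂ n))) α₂) ∧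
    (AEle (fun _ => 2) α₁ → PowLL α₁ α₂ →
      PowLL α₁ (fun n => 2 ^ Nat.sqrt (Nat.log 2 (α₁ n) * Nat.log 2 (α₂ n))) ∧
      PowLL (fun n => 2 ^ Nat.sqrt (Nat.log 2 (α₁ n) * Nat.log 2 (α₂ n))) α₂) := by
  set α : ℕ → ℕ := fun n => 2 ^ Nat.sqrt (Nat.log 2 (α₁ n) * Nat.log 2 (α₂ n)) with hα
  have hlog : ∀ n, Nat.log 2 (α n) = Nat.sqrt (Nat.log 2 (α₁ n) * Nat.log 2 (α₂ n)) :=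
    fun n => Nat.log_pow (by norm_num) _
  have hα2 : AEle (fun _ => 2) α₁ → AEle (fun _ => 2) α₂ → AEle (fun _ => 2) α := by
    intro h1 h2
    filter_upwards [h1, h2] with n h1 h2
    have := (sq_bd (lg_bd h1).1 (lg_bd h2).1).1
    exact Nat.pow_le_pow_right (n := 2) (by norm_num) this
  have hle2 : AEle (fun _ => 2) α₁ → PowLe α₁ α₂ → AEle (fun _ => 2) α₂ := by
    intro h1 h
    obtain ⟨l, hl⟩ := h 1
    filter_upwards [h1, hl, h1₂] with n h1 h2 h3
    by_contra hc
    have : α₂ n = 1 := by omega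
    simp [this] at h2
    omega
  have P1 : AEle (fun _ => 2) α₁ → PowLe α₁ α₂ → PowLe α₁ α ∧ PowLe α α₂ := by
    intro h1 h
    have h2 := hle2 h1 h
    have h3 := hα2 h1 h2
    rw [powLe_iff h1 h2] at h
    rw [powLe_iff h1 h3, powLe_iff h3 h2]
    obtain ⟨c, hc1, hc⟩ := h
    constructor
    · refine ⟨2 * c, by omega, ?_⟩
      filter_upwards [h1, h2, hc] with n h1 h2 h
      rw [hlog]
      obtain ⟨s1, s2, s3⟩ := sq_bd (lg_bd h1).1 (lg_bd h2).1
      apply le_of_sq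
      calc Nat.log 2 (α₁ n) ^ 2 ≤ c * (Nat.log 2 (α₁ n) * Nat.log 2 (α₂ n)) := by nlinarith
        _ ≤ c ^ 2 * (Nat.log 2 (α₁ n) * Nat.log 2 (α₂ n)) :=
          Nat.mul_le_mul_right _ (by nlinarith)
        _ ≤ c ^ 2 * _ := Nat.mul_le_mul_left _ s3
        _ = _ := by ring
    · refine ⟨c, hc1, ?_⟩
      filter_upwards [h1, h2, hc] with n h1 h2 h
      rw [hlog]
      obtain ⟨s1, s2, s3⟩ := sq_bd (lg_bd h1).1 (lg_bd h2).1
      apply le_of_sq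
      calc _ ≤ Nat.log 2 (α₁ n) * Nat.log 2 (α₂ n) := s2
        _ ≤ c * Nat.log 2 (α₂ n) * Nat.log 2 (α₂ n) := Nat.mul_le_mul_right _ h
        _ = c * Nat.log 2 (α₂ n) ^ 2 := by ring
        _ ≤ c ^ 2 * Nat.log 2 (α₂ n) ^ 2 := Nat.mul_le_mul_right _ (by nlinarith)
        _ = _ := by ring
  refine ⟨P1, ?_, ?_⟩
  · rintro h1 ⟨h, hn⟩
    have h2 := hle2 h1 h
    have h3 := hα2 h1 h2
    obtain ⟨p, q⟩ := P1 h1 h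
    rw [powLe_iff h2 h1] at hn
    refine ⟨⟨p, fun r => hn ?_⟩, ⟨q, fun r => hn ?_⟩⟩
    · rw [powLe_iff h3 h1] at r
      obtain ⟨c, hc1, hc⟩ := r
      refine ⟨4 * c ^ 2, by nlinarith, ?_⟩
      filter_upwards [h1, h2, hc] with n h1 h2 h
      rw [hlog] at h
      have a1 := (lg_bd h1).1
      obtain ⟨s1, s2, s3⟩ := sq_bd (lg_bd h1).1 (lg_bd h2).1
      refine Nat.le_of_mul_le_mul_left ?_ a1
      calc _ ≤ _ := s3
        _ ≤ 4 * (c * Nat.log 2 (α₁ n)) ^ 2 := Nat.mul_le_mul_left _ (Nat.pow_le_pow_left h 2)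
        _ = _ := by ring
    · rw [powLe_iff h2 h3] at r
      obtain ⟨c, hc1, hc⟩ := r
      refine ⟨c ^ 2, by nlinarith, ?_⟩
      filter_upwards [h1, h2, hc] with n h1 h2 h
      rw [hlog] at h
      have b1 := (lg_bd h2).1
      obtain ⟨s1, s2, s3⟩ := sq_bd (lg_bd h1).1 (lg_bd h2).1
      refine Nat.le_of_mul_le_mul_left ?_ b1
      calc _ = Nat.log 2 (α₂ n) ^ 2 := by ring
        _ ≤ _ := Nat.pow_le_pow_left h 2
        _ = c ^ 2 * Nat.sqrt (Nat.log 2 (α₁ n) * Nat.log 2 (α₂ n)) ^ 2 := by ring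
        _ ≤ c ^ 2 * _ := Nat.mul_le_mul_left _ s2
        _ = _ := by ring
  · intro h1 h
    have h2 : AEle (fun _ => 2) α₂ := by
      filter_upwards [h1, h 1] with n h1 h
      simp only [pow_one] at h
      omega
    have h3 := hα2 h1 h2
    rw [powLL_iff h1 h2] at h
    rw [powLL_iff h1 h3, powLL_iff h3 h2]
    constructor
    · intro k
      filter_upwards [h1, h2, h (4 * k ^ 2)] with n h1 h2 h
      rw [hlog]
      obtain ⟨s1, s2, s3⟩ := sq_bd (lg_bd h1).1 (lg_bd h2).1
      apply le_of_sq
      have := Nat.mul_le_mul_left (Nat.log 2 (α₁ n)) h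
      nlinarith
    · intro k
      filter_upwards [h1, h2, h (k ^ 2)] with n h1 h2 h
      rw [hlog]
      obtain ⟨s1, s2, s3⟩ := sq_bd (lg_bd h1).1 (lg_bd h2).1
      apply le_of_sq
      calc _ = k ^ 2 * Nat.sqrt (Nat.log 2 (α₁ n) * Nat.log 2 (α₂ n)) ^ 2 := by ring
        _ ≤ k ^ 2 * _ := Nat.mul_le_mul_left _ s2
        _ = k ^ 2 * Nat.log 2 (α₁ n) * Nat.log 2 (α₂ n) := by ring
        _ ≤ Nat.log 2 (α₂ n) * Nat.log 2 (α₂ n) := Nat.mul_le_mul_right _ h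
        _ = _ := by ring
end

section
/- Let α₁ and α₂ be nondecreasing, e-consistent functions ℕ → ℕ with 1 ≤ₐₑ α_i(n) and α_i(n) ≤ₐₑ log(n) for i = 1, 2. Then the function α defined by α(n) = 2^{msqrt( mlog(α₁(n)) · mlog(α₂(n)) )} is also nondecreasing, e-consistent, and satisfies 1 ≤ₐₑ α(n) and α(n) ≤ₐₑ log(n). -/
open Filter

theorem log_aux (x y l : ℕ) (h : y ≤ x ^ l) : Nat.log 2 y ≤ 2 * l * Nat.log 2 x := by
  rcases Nat.lt_or_ge x 2 with hx | hx
  · have h1 : x ^ l ≤ 1 := pow_le_one₀ (Nat.zero_le _) (by omega)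
    have : Nat.log 2 y = 0 := Nat.log_of_lt (by omega)
    omega
  · have ha : 1 ≤ Nat.log 2 x := Nat.log_pos (by norm_num) hx
    have hlt : x ≤ 2 ^ (Nat.log 2 x + 1) := (Nat.lt_pow_succ_log_self (by norm_num) x).le
    have h2 : y ≤ 2 ^ ((Nat.log 2 x + 1) * l) := by
      rw [pow_mul]
      exact h.trans (Nat.pow_le_pow_left hlt l)
    have h3 : Nat.log 2 y ≤ (Nat.log 2 x + 1) * l := by
      have := Nat.log_mono_right (b := 2) h2
      rwa [Nat.log_pow (by norm_num)] at this
    nlinarith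

theorem sqrt_aux (a b A B l m : ℕ) (hA : A ≤ 2 * l * a) (hB : B ≤ 2 * m * b) :
    Nat.sqrt (A * B) ≤ Nat.sqrt (a * b) * (4 * (l * m)) := by
  have hAB : A * B ≤ 4 * (l * m) * (a * b) := by
    calc A * B ≤ (2 * l * a) * (2 * m * b) := Nat.mul_le_mul hA hB
      _ = _ := by ring
  have hs : a * b ≤ 4 * (Nat.sqrt (a * b) * Nat.sqrt (a * b)) := by
    rcases Nat.eq_zero_or_pos (a * b) with h0 | h0
    · omega
    · have h1 : 0 < Nat.sqrt (a * b) := Nat.sqrt_pos.2 h0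
      have h2 := Nat.lt_succ_sqrt (a * b)
      simp only [Nat.succ_eq_add_one] at h2
      nlinarith
  generalize Nat.sqrt (a * b) = s at *
  generalize l * m = c at *
  have : Nat.sqrt (A * B) ≤ Nat.sqrt ((s * (4 * c)) * (s * (4 * c))) := by
    apply Nat.sqrt_le_sqrt
    have h1 : 4 * c * (a * b) ≤ 4 * c * (4 * (s * s)) := Nat.mul_le_mul_left _ hs
    have h2 : c * (s * s) ≤ c * c * (s * s) := Nat.mul_le_mul_right _ (Nat.le_mul_self c)
    nlinarith
  rwa [Nat.sqrt_eq] at this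

theorem stmt15 (α₁ α₂ : ℕ → ℕ) (hm₁ : Monotone α₁) (hm₂ : Monotone α₂)
    (he₁ : ECons α₁) (he₂ : ECons α₂)
    (h1₁ : AEle (fun _ => 1) α₁) (hl₁ : AEle α₁ plog)
    (h1₂ : AEle (fun _ => 1) α₂) (hl₂ : AEle α₂ plog) :
    Monotone (fun n => 2 ^ Nat.sqrt (Nat.log 2 (α₁ n) * Nat.log 2 (α₂ n))) ∧
    ECons (fun n => 2 ^ Nat.sqrt (Nat.log 2 (α₁ n) * Nat.log 2 (α₂ n))) ∧
    AEle (fun _ => 1) (fun n => 2 ^ Nat.sqrt (Nat.log 2 (α₁ n) * Nat.log 2 (α₂ n))) ∧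
    AEle (fun n => 2 ^ Nat.sqrt (Nat.log 2 (α₁ n) * Nat.log 2 (α₂ n))) plog := by
  refine ⟨?_, ?_, ?_, ?_⟩
  · intro x y hxy
    exact Nat.pow_le_pow_right (by norm_num) (Nat.sqrt_le_sqrt (Nat.mul_le_mul
      (Nat.log_mono_right (hm₁ hxy)) (Nat.log_mono_right (hm₂ hxy))))
  · intro k
    obtain ⟨l, hl⟩ := he₁ k
    obtain ⟨m, hm⟩ := he₂ k
    refine ⟨4 * (l * m), ?_⟩
    filter_upwards [hl, hm] with n h1 h2
    rw [← pow_mul]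
    exact Nat.pow_le_pow_right (by norm_num)
      (sqrt_aux _ _ _ _ _ _ (log_aux _ _ _ h1) (log_aux _ _ _ h2))
  · exact Eventually.of_forall fun n => Nat.one_le_two_pow
  · unfold AEle at *
    filter_upwards [h1₁, h1₂, hl₁, hl₂] with n h1 h2 h3 h4
    have ha := Nat.pow_log_le_self 2 (x := α₁ n) (by omega)
    have hb := Nat.pow_log_le_self 2 (x := α₂ n) (by omega)
    generalize Nat.log 2 (α₁ n) = a at *
    generalize Nat.log 2 (α₂ n) = b at *
    have hs : Nat.sqrt (a * b) ≤ max a b := by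
      rw [← Nat.sqrt_eq (max a b)]
      exact Nat.sqrt_le_sqrt (Nat.mul_le_mul (le_max_left _ _) (le_max_right _ _))
    have := Nat.pow_le_pow_right (n := 2) (by norm_num) hs
    rcases max_cases a b with ⟨h, -⟩ | ⟨h, -⟩ <;> rw [h] at this <;> omega
end

section
/- There exists a set U₁ of bound functions, each of the form β(n) = n·α(n) with α : ℕ → ℕ nondecreasing, f-consistent and satisfying 2 ≤ₐₑ α(n) ≤ₐₑ n, such that: (1) U₁ is tame; (2) U₁ contains the functions n ↦ 2n, n ↦ n·log*(n), n ↦ n·log^⟨m⟩(n) for every m ≥ 1, and n ↦ n²; (3) U₁ is densely linearly ordered by ≤it, i.e. any two distinct β₁, β₂ ∈ U₁ satisfy β₁ <it β₂ or β₂ <it β₁, and whenever β₁ <it β₂ for β₁, β₂ ∈ U₁ there is β₃ ∈ U₁ with β₁ <it β₃ <it β₂; (4) for β_i(n) = n·α_i(n) with β₁, β₂ ∈ U₁ it holds: β₁ <it β₂ iff α₁ ≪pow α₂. -/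
open Filter

/-- The admissible factor functions. -/
structure Nice (α : ℕ → ℕ) : Prop where
  mono : Monotone α
  fcons : FCons α
  two_le : AEle (fun _ => 2) α
  le_id : AEle α (fun n => n)
  pos : ∀ n, n ≤ n * α n

theorem PowLL.trans {a b c : ℕ → ℕ} (h1 : PowLL a b) (h2 : PowLL b c) : PowLL a c := by
  intro k
  have h3 := h1 k
  have h4 := h2 1
  unfold AEle at *
  filter_upwards [h3, h4] with n h3 h4
  simp only [pow_one] at h4
  exact h3.trans h4

theorem interp {a b : ℕ → ℕ} (ha : Nice a) (hb : Nice b) (hab : PowLL a b) :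
    ∃ c, Nice c ∧ PowLL a c ∧ PowLL c b := by
  set A : ℕ → ℕ := fun n => Nat.clog 2 (a n) with hA
  set B : ℕ → ℕ := fun n => Nat.log 2 (b n) with hB
  have hAm : Monotone A := fun x y h => Nat.clog_mono_right 2 (ha.mono h)
  have hBm : Monotone B := fun x y h => Nat.log_mono_right (hb.mono h)
  have hA1 : ∀ᶠ n in atTop, 1 ≤ A n := by
    filter_upwards [ha.two_le] with n hn
    exact Nat.clog_pos (by norm_num) hn
  have hB1 : ∀ᶠ n in atTop, 1 ≤ B n := by
    filter_upwards [hb.two_le] with n hn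
    exact Nat.log_pos (by norm_num) hn
  have haA : ∀ n, a n ≤ 2 ^ A n := fun n => Nat.le_pow_clog (by norm_num) _
  have hBb : ∀ᶠ n in atTop, 2 ^ B n ≤ b n := by
    filter_upwards [hb.two_le] with n hn
    exact Nat.pow_log_le_self 2 (by omega)
  have key : ∀ j : ℕ, ∀ᶠ n in atTop, j * A n ≤ B n := by
    intro j
    filter_upwards [hab (2 * j), ha.two_le, hb.two_le, hA1] with n h1 h2 h3 h4
    apply Nat.le_log_of_pow_le (by norm_num)
    refine le_trans ?_ h1
    rw [mul_comm, pow_mul, pow_mul]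
    apply Nat.pow_le_pow_left
    have h5 := Nat.pow_pred_clog_lt_self (b := 2) (by norm_num) (x := a n) h2
    have h6 : 2 ^ A n = 2 * 2 ^ (A n).pred := by
      rw [← pow_succ', Nat.pred_eq_sub_one, Nat.sub_add_cancel h4]
    rw [h6, pow_two]
    exact Nat.mul_le_mul h2 h5.le
  have hac : ∀ k : ℕ, ∀ᶠ n in atTop, k * A n ≤ Nat.sqrt (A n * B n) := by
    intro k
    filter_upwards [key (k * k)] with n h
    rw [Nat.le_sqrt]
    calc k * A n * (k * A n) = A n * (k * k * A n) := by ring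
      _ ≤ _ := Nat.mul_le_mul_left _ h
  have hcb : ∀ k : ℕ, ∀ᶠ n in atTop, k * Nat.sqrt (A n * B n) ≤ B n := by
    intro k
    filter_upwards [key (k * k)] with n h
    apply Nat.mul_self_le_mul_self_iff.1
    have := Nat.sqrt_le (A n * B n)
    calc k * Nat.sqrt (A n * B n) * (k * Nat.sqrt (A n * B n))
        = k * k * (Nat.sqrt (A n * B n) * Nat.sqrt (A n * B n)) := by ring
      _ ≤ k * k * (A n * B n) := Nat.mul_le_mul_left _ this
      _ = k * k * A n * B n := by ring
      _ ≤ _ := Nat.mul_le_mul_right _ h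
  have P1 : PowLL a (fun n => 2 ^ Nat.sqrt (A n * B n)) := by
    intro k
    filter_upwards [hac k] with n h
    calc a n ^ k ≤ (2 ^ A n) ^ k := Nat.pow_le_pow_left (haA n) k
      _ = 2 ^ (k * A n) := by rw [← pow_mul, mul_comm]
      _ ≤ _ := Nat.pow_le_pow_right (by norm_num) h
  have P2 : PowLL (fun n => 2 ^ Nat.sqrt (A n * B n)) b := by
    intro k
    filter_upwards [hcb k, hBb] with n h h'
    refine le_trans ?_ h'
    rw [← pow_mul, mul_comm]
    exact Nat.pow_le_pow_right (by norm_num) h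
  refine ⟨fun n => 2 ^ Nat.sqrt (A n * B n), ⟨?_, ?_, ?_, ?_, ?_⟩, P1, P2⟩
  · intro x y h
    exact Nat.pow_le_pow_right (by norm_num)
      (Nat.sqrt_le_sqrt (Nat.mul_le_mul (hAm h) (hBm h)))
  · intro k
    obtain ⟨l, hl⟩ := ha.fcons k
    obtain ⟨l', hl'⟩ := hb.fcons k
    refine ⟨2 * (l * (2 * l')), ?_⟩
    filter_upwards [hl, hl', hA1, hB1] with n h1 h2 h3 h4
    rw [← pow_mul]
    apply Nat.pow_le_pow_right (by norm_num)
    have e1 : A (n ^ k) ≤ l * A n := by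
      apply Nat.clog_le_of_le_pow
      refine h1.trans ?_
      rw [mul_comm, pow_mul]
      exact Nat.pow_le_pow_left (haA n) l
    have e2 : B (n ^ k) ≤ 2 * l' * B n := by
      have : b (n ^ k) ≤ 2 ^ (2 * l' * B n) := by
        refine h2.trans ?_
        calc b n ^ l' ≤ (2 ^ (B n + 1)) ^ l' :=
              Nat.pow_le_pow_left (Nat.lt_pow_succ_log_self (by norm_num) _).le _
          _ = 2 ^ ((B n + 1) * l') := by rw [← pow_mul]
          _ ≤ _ := Nat.pow_le_pow_right (by norm_num) (by nlinarith)
      calc B (n ^ k) ≤ Nat.log 2 (2 ^ (2 * l' * B n)) := Nat.log_mono_right this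
        _ = _ := Nat.log_pow (by norm_num) _
    set X := A n * B n with hX
    set s := Nat.sqrt X with hs
    have hs1 : 1 ≤ s := by
      rw [hs, Nat.le_sqrt]; nlinarith
    have hXs : X ≤ 4 * (s * s) := by
      have := Nat.lt_succ_sqrt X
      rw [← hs] at this
      simp only [Nat.succ_eq_add_one] at this
      nlinarith
    have e3 : A (n ^ k) * B (n ^ k) ≤ (l * (2 * l')) * X := by
      calc _ ≤ (l * A n) * (2 * l' * B n) := Nat.mul_le_mul e1 e2
        _ = _ := by rw [hX]; ring
    set c := l * (2 * l') with hc
    apply Nat.mul_self_le_mul_self_iff.1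
    refine (Nat.sqrt_le _).trans (e3.trans ?_)
    have : c ≤ c * c := Nat.le_mul_self c
    calc c * X ≤ (c * c) * (4 * (s * s)) := Nat.mul_le_mul this hXs
      _ = _ := by ring
  · filter_upwards [P1 1, ha.two_le] with n h1 h2
    simp only [pow_one] at h1
    exact h2.trans h1
  · filter_upwards [P2 1, hb.le_id] with n h1 h2
    simp only [pow_one] at h1
    exact h1.trans h2
  · intro n
    exact Nat.le_mul_of_pos_right _ (by positivity)

theorem Nice.mono_mul {a : ℕ → ℕ} (ha : Nice a) : Monotone (fun n => n * a n) :=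
  fun _ _ h => Nat.mul_le_mul h (ha.mono h)

theorem Nice.le_iter {a : ℕ → ℕ} (ha : Nice a) (m n : ℕ) : n ≤ (fun n => n * a n)^[m] n := by
  induction m with
  | zero => simp
  | succ m ih =>
    rw [Function.iterate_succ_apply']
    exact ih.trans (ha.pos _)

theorem iter_bound {a : ℕ → ℕ} (ha : Nice a) (m : ℕ) :
    ∃ l, ∀ᶠ n in atTop, (fun n => n * a n)^[m] n ≤ n * a n ^ l ∧
      (fun n => n * a n)^[m] n ≤ n ^ (2 ^ m) := by
  induction m with
  | zero => exact ⟨0, by simp⟩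
  | succ m ih =>
    obtain ⟨l, hl⟩ := ih
    obtain ⟨l', hl'⟩ := ha.fcons (2 ^ m)
    refine ⟨l + l', ?_⟩
    obtain ⟨N, hN⟩ := eventually_atTop.1 ha.le_id
    filter_upwards [hl, hl', eventually_ge_atTop N] with n h1 h2 h3
    rw [Function.iterate_succ_apply']
    set y := (fun n => n * a n)^[m] n with hy
    have hny : n ≤ y := ha.le_iter m n
    constructor
    · calc y * a y ≤ (n * a n ^ l) * a (n ^ (2 ^ m)) := Nat.mul_le_mul h1.1 (ha.mono h1.2)
        _ ≤ (n * a n ^ l) * a n ^ l' := Nat.mul_le_mul_left _ h2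
        _ = _ := by ring
    · calc y * a y ≤ y * y := Nat.mul_le_mul_left _ (hN y (h3.trans hny))
        _ ≤ n ^ (2 ^ m) * n ^ (2 ^ m) := Nat.mul_le_mul h1.2 h1.2
        _ = _ := by rw [← pow_add]; congr 1; ring

theorem leIt_of_powLL {a b : ℕ → ℕ} (ha : Nice a) (hb : Nice b) (hab : PowLL a b) :
    LeIt (fun n => n * a n) (fun n => n * b n) := by
  rintro _ ⟨m, hm, rfl⟩
  refine ⟨_, ⟨m, hm, rfl⟩, ?_⟩
  obtain ⟨N, hN⟩ := eventually_atTop.1 (hab 1)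
  simp only [pow_one] at hN
  filter_upwards [eventually_ge_atTop N] with n hn
  clear hm
  induction m with
  | zero => simp
  | succ m ih =>
    rw [Function.iterate_succ_apply', Function.iterate_succ_apply']
    exact (Nat.mul_le_mul_left _ (hN _ (hn.trans (ha.le_iter m n)))).trans (hb.mono_mul ih)

theorem ltIt_of_powLL {a b : ℕ → ℕ} (ha : Nice a) (hb : Nice b) (hab : PowLL a b) :
    LtIt (fun n => n * a n) (fun n => n * b n) := by
  refine ⟨leIt_of_powLL ha hb hab, fun h => ?_⟩
  obtain ⟨_, ⟨m, hm, rfl⟩, h⟩ := h _ ⟨1, le_rfl, rfl⟩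
  obtain ⟨l, hl⟩ := iter_bound ha m
  have : ∀ᶠ n : ℕ in atTop, False := by
    filter_upwards [h, hl, hab (l + 1), ha.two_le, eventually_ge_atTop 1] with n h1 h2 h3 h4 h5
    simp only [Function.iterate_one] at h1
    have h6 := Nat.le_of_mul_le_mul_left (h1.trans h2.1) h5
    have h7 := h3.trans h6
    have h8 : 0 < a n ^ l := by positivity
    rw [pow_succ] at h7
    nlinarith
  obtain ⟨n, hn⟩ := this.exists
  exact hn

theorem PowLL.tendsto {a b : ℕ → ℕ} (ha : Nice a) (hab : PowLL a b) :
    ∀ k : ℕ, ∀ᶠ n in atTop, 2 ^ k * a n ≤ b n := by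
  intro k
  filter_upwards [hab (k + 1), ha.two_le] with n h1 h2
  refine le_trans ?_ h1
  rw [pow_succ]
  exact Nat.mul_le_mul_right _ (Nat.pow_le_pow_left h2 k)

theorem ratio_atTop {a b : ℕ → ℕ} (ha : Nice a) (hab : PowLL a b) :
    Tendsto (fun n => ((n * b n : ℕ) : ℝ) / ((n * a n : ℕ) : ℝ)) atTop atTop := by
  rw [tendsto_atTop]
  intro M
  obtain ⟨k, hk⟩ := pow_unbounded_of_one_lt M (by norm_num : (1 : ℝ) < 2)
  filter_upwards [PowLL.tendsto ha hab k, ha.two_le, eventually_ge_atTop 1] with n h1 h2 h3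
  have : 0 < n * a n := by positivity
  rw [le_div_iff₀ (by exact_mod_cast this)]
  have h4 : 2 ^ k * (n * a n) ≤ n * b n := by
    calc 2 ^ k * (n * a n) = n * (2 ^ k * a n) := by ring
      _ ≤ _ := Nat.mul_le_mul_left _ h1
  have h5 : ((2 ^ k * (n * a n) : ℕ) : ℝ) ≤ ((n * b n : ℕ) : ℝ) := by exact_mod_cast h4
  refine le_trans ?_ h5
  push_cast
  exact mul_le_mul_of_nonneg_right hk.le (by positivity)

theorem ratio_zero {a b : ℕ → ℕ} (ha : Nice a) (hab : PowLL a b) :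
    Tendsto (fun n => ((n * a n : ℕ) : ℝ) / ((n * b n : ℕ) : ℝ)) atTop (nhds 0) := by
  have := (ratio_atTop ha hab).inv_tendsto_atTop
  refine this.congr fun n => ?_
  simp

theorem ratio_one {a : ℕ → ℕ} (ha : Nice a) :
    Tendsto (fun n => ((n * a n : ℕ) : ℝ) / ((n * a n : ℕ) : ℝ)) atTop (nhds 1) := by
  apply tendsto_const_nhds.congr'
  filter_upwards [ha.two_le, eventually_ge_atTop 1] with n h2 h3
  have : 0 < n * a n := by positivity
  have h : ((n * a n : ℕ) : ℝ) ≠ 0 := by exact_mod_cast this.ne'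
  rw [div_self h]

theorem plog_mono : Monotone plog := fun _ _ h =>
  max_le_max le_rfl (Nat.clog_mono_right 2 h)

theorem plog_pos (n : ℕ) : 1 ≤ plog n := le_max_left _ _

theorem le_pow_plog (n : ℕ) : n ≤ 2 ^ plog n :=
  (Nat.le_pow_clog (by norm_num) n).trans (Nat.pow_le_pow_right (by norm_num) (le_max_right _ _))

theorem plog_le_of {n m : ℕ} (hm : 1 ≤ m) (h : n ≤ 2 ^ m) : plog n ≤ m :=
  max_le hm (Nat.clog_le_of_le_pow h)

theorem plog_one : plog 1 = 1 := by simp [plog]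

theorem plog_lt {n : ℕ} (hn : 2 ≤ n) : plog n < n := by
  have : plog n ≤ n - 1 := by
    apply plog_le_of (by omega)
    have := Nat.lt_two_pow_self (n := n - 1)
    omega
  omega

theorem plog_le {n : ℕ} (hn : 1 ≤ n) : plog n ≤ n := plog_le_of hn Nat.lt_two_pow_self.le

theorem plog_tendsto : Tendsto plog atTop atTop := by
  rw [tendsto_atTop]
  intro m
  filter_upwards [eventually_ge_atTop (2 ^ m)] with n hn
  exact (Nat.pow_le_pow_iff_right (by norm_num : 1 < 2)).1 (hn.trans (le_pow_plog n))

theorem plog_pow_le (a l : ℕ) : plog (a ^ l) ≤ (l + 1) * plog a := by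
  have := plog_pos a
  apply plog_le_of (by nlinarith)
  calc a ^ l ≤ (2 ^ plog a) ^ l := Nat.pow_le_pow_left (le_pow_plog a) l
    _ = 2 ^ (plog a * l) := by rw [← pow_mul]
    _ ≤ _ := Nat.pow_le_pow_right (by norm_num) (by nlinarith)

theorem plog_pow_small (k : ℕ) : ∀ᶠ n in atTop, plog n ^ k ≤ n := by
  have h := tendsto_pow_const_div_const_pow_of_one_lt k (by norm_num : (1 : ℝ) < 2)
  have h1 : ∀ᶠ L : ℕ in atTop, (L : ℝ) ^ k / 2 ^ L < 1 / 2 :=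
    h.eventually (gt_mem_nhds (by norm_num))
  filter_upwards [plog_tendsto.eventually h1, eventually_ge_atTop 2] with n h2 h3
  rw [div_lt_iff₀ (by positivity)] at h2
  have h4 : 2 ^ plog n < 2 * n := by
    have h5 := Nat.pow_pred_clog_lt_self (b := 2) (by norm_num) (x := n) h3
    have h6 : 1 ≤ Nat.clog 2 n := Nat.clog_pos (by norm_num) h3
    have h7 : plog n = Nat.clog 2 n := max_eq_right h6
    rw [h7]
    have h8 : 2 ^ Nat.clog 2 n = 2 * 2 ^ (Nat.clog 2 n).pred := by
      rw [← pow_succ', Nat.pred_eq_sub_one, Nat.sub_add_cancel h6]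
    omega
  have h9 : ((2 ^ plog n : ℕ) : ℝ) < ((2 * n : ℕ) : ℝ) := by exact_mod_cast h4
  push_cast at h9
  have : ((plog n : ℕ) : ℝ) ^ k < (n : ℝ) := by linarith
  exact_mod_cast this.le

theorem iter_tendsto_s16 (m : ℕ) : Tendsto (plog^[m]) atTop atTop := by
  induction m with
  | zero => exact tendsto_id
  | succ m ih => exact ih.comp plog_tendsto

theorem iter_mono (m : ℕ) : Monotone (plog^[m]) := plog_mono.iterate m

theorem iter_pos (m : ℕ) {n : ℕ} (hn : 1 ≤ n) : 1 ≤ plog^[m] n := by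
  cases m with
  | zero => exact hn
  | succ m => rw [Function.iterate_succ_apply']; exact plog_pos _

theorem iter_powLL_succ (m : ℕ) : PowLL (plog^[m + 1]) (plog^[m]) := by
  intro k
  filter_upwards [(iter_tendsto_s16 m).eventually (plog_pow_small k)] with n h
  rw [Function.iterate_succ_apply']
  exact h

theorem iter_powLL {i j : ℕ} (h : i < j) : PowLL (plog^[j]) (plog^[i]) := by
  induction j, h using Nat.le_induction with
  | base => exact iter_powLL_succ i
  | succ j _ ih => exact (iter_powLL_succ j).trans ih

theorem iter_fcons (m : ℕ) : FCons (plog^[m]) := by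
  induction m with
  | zero => intro k; exact ⟨k, by simp⟩
  | succ m ih =>
    intro k
    obtain ⟨l, hl⟩ := ih k
    refine ⟨l + 1 + 1, ?_⟩
    filter_upwards [hl, (iter_tendsto_s16 (m + 1)).eventually_ge_atTop 2] with n h1 h2
    rw [Function.iterate_succ_apply'] at h2 ⊢
    rw [Function.iterate_succ_apply']
    calc _ ≤ plog ((plog^[m] n) ^ l) := plog_mono h1
      _ ≤ (l + 1) * plog (plog^[m] n) := plog_pow_le _ _
      _ ≤ plog (plog^[m] n) ^ (l + 1) * plog (plog^[m] n) := by
        apply Nat.mul_le_mul_right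
        exact Nat.lt_two_pow_self.le.trans (Nat.pow_le_pow_left h2 _)
      _ = _ := (pow_succ _ _).symm

theorem iter_nice (m : ℕ) : Nice (plog^[m]) where
  mono := iter_mono m
  fcons := iter_fcons m
  two_le := (iter_tendsto_s16 m).eventually_ge_atTop 2
  le_id := by
    rcases Nat.eq_zero_or_pos m with rfl | h
    · exact Eventually.of_forall fun n => le_rfl
    · filter_upwards [iter_powLL h 1] with n hn
      simpa using hn
  pos := by
    intro n
    rcases Nat.eq_zero_or_pos n with rfl | h
    · simp
    · exact Nat.le_mul_of_pos_right _ (iter_pos m h)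

theorem two_nice : Nice (fun _ => 2) where
  mono := monotone_const
  fcons := fun k => ⟨1, by simp⟩
  two_le := Eventually.of_forall fun n => le_rfl
  le_id := eventually_ge_atTop 2
  pos := by intro n; omega

theorem exists_iter (n : ℕ) : ∃ m, 1 ≤ m ∧ plog^[m] n = 1 := by
  induction n using Nat.strong_induction_on with
  | _ n ih =>
    by_cases hn : 2 ≤ n
    · obtain ⟨m, hm, h⟩ := ih (plog n) (plog_lt hn)
      exact ⟨m + 1, by omega, h⟩
    · refine ⟨1, le_rfl, ?_⟩
      have : n = 0 ∨ n = 1 := by omega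
      rcases this with rfl | rfl <;> simp [plog]

theorem logstar_spec (n : ℕ) : 1 ≤ logstar n ∧ plog^[logstar n] n = 1 :=
  Nat.sInf_mem (s := {m : ℕ | 1 ≤ m ∧ plog^[m] n = 1}) (exists_iter n)

theorem logstar_le {n m : ℕ} (hm : 1 ≤ m) (h : plog^[m] n = 1) : logstar n ≤ m :=
  Nat.sInf_le ⟨hm, h⟩

theorem logstar_mono : Monotone logstar := by
  intro x y h
  have hs := logstar_spec y
  apply logstar_le hs.1
  have h1 := iter_mono (logstar y) h
  rw [hs.2] at h1
  apply le_antisymm h1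
  obtain ⟨k, hk⟩ : ∃ k, logstar y = k + 1 := ⟨logstar y - 1, by omega⟩
  rw [hk, Function.iterate_succ_apply']
  exact plog_pos _

theorem logstar_add (m n : ℕ) : logstar n ≤ m + logstar (plog^[m] n) := by
  have hs := logstar_spec (plog^[m] n)
  apply logstar_le (by omega)
  rw [add_comm, Function.iterate_add_apply]
  exact hs.2

theorem logstar_le_succ (n : ℕ) : logstar n ≤ n + 1 := by
  induction n using Nat.strong_induction_on with
  | _ n ih =>
    by_cases hn : 2 ≤ n
    · have h1 := ih (plog n) (plog_lt hn)
      have h2 := logstar_add 1 n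
      have h3 := plog_lt hn
      simp only [Function.iterate_one] at h2
      omega
    · have : logstar n ≤ 1 := by
        apply logstar_le le_rfl
        have : n = 0 ∨ n = 1 := by omega
        rcases this with rfl | rfl <;> simp [plog]
      omega

theorem iter_one (m : ℕ) : plog^[m] 1 = 1 := Function.iterate_fixed plog_one m

theorem logstar_tendsto : Tendsto logstar atTop atTop := by
  rw [tendsto_atTop]
  intro m
  filter_upwards [(iter_tendsto_s16 m).eventually_ge_atTop 2] with n h
  by_contra hlt
  push Not at hlt
  have hs := (logstar_spec n).2
  have : plog^[m] n = 1 := by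
    obtain ⟨d, hd⟩ := Nat.exists_eq_add_of_lt hlt
    have : m = (d + 1) + logstar n := by omega
    rw [this, Function.iterate_add_apply, hs, iter_one]
  omega

theorem logstar_powLL (m : ℕ) : PowLL logstar (plog^[m]) := by
  intro k
  filter_upwards [(iter_tendsto_s16 m).eventually (plog_pow_small (2 * k)),
    (iter_tendsto_s16 (m + 1)).eventually_ge_atTop (m + 3)] with n h1 h2
  have h3 := logstar_add (m + 1) n
  have h4 := logstar_le_succ (plog^[m + 1] n)
  rw [Function.iterate_succ_apply'] at h2 h3 h4
  refine le_trans ?_ h1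
  rw [pow_mul]
  apply Nat.pow_le_pow_left
  nlinarith

theorem two_powLL_logstar : PowLL (fun _ => 2) logstar := fun k =>
  logstar_tendsto.eventually_ge_atTop (2 ^ k)

theorem logstar_fcons : FCons logstar := by
  intro k
  refine ⟨2, ?_⟩
  filter_upwards [plog_pow_small 2, plog_tendsto.eventually_ge_atTop (k + 1),
    logstar_tendsto.eventually_ge_atTop 2] with n h1 h2 h3
  have h4 := logstar_add 1 (n ^ k)
  simp only [Function.iterate_one] at h4
  have h5 : plog (n ^ k) ≤ n := by
    refine (plog_pow_le n k).trans (le_trans ?_ h1)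
    rw [pow_two]
    exact Nat.mul_le_mul_right _ h2
  have h6 := logstar_mono h5
  nlinarith

theorem logstar_nice : Nice logstar where
  mono := logstar_mono
  fcons := logstar_fcons
  two_le := logstar_tendsto.eventually_ge_atTop 2
  le_id := by
    filter_upwards [logstar_powLL 0 1] with n hn
    simpa using hn
  pos := fun n => Nat.le_mul_of_pos_right _ (logstar_spec n).1

/-- The ordering by `PowLL` on the admissible factor functions. -/
def NiceR (a b : {α : ℕ → ℕ // Nice α}) : Prop := PowLL a.1 b.1 ∨ PowLL b.1 a.1

theorem base_chain : IsChain NiceR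
    {x | x.1 = (fun _ => 2) ∨ x.1 = logstar ∨ ∃ m, x.1 = plog^[m]} := by
  rintro ⟨a, ha⟩ hx ⟨b, hb⟩ hy hne
  left
  simp only [Set.mem_ofPred_eq] at hx hy
  have hne' : a ≠ b := fun h => hne (Subtype.ext h)
  simp only [NiceR]
  rcases hx with rfl | rfl | ⟨m, rfl⟩ <;> rcases hy with rfl | rfl | ⟨m', rfl⟩
  · exact absurd rfl hne'
  · exact Or.inl two_powLL_logstar
  · exact Or.inl (two_powLL_logstar.trans (logstar_powLL _))
  · exact Or.inr two_powLL_logstar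
  · exact absurd rfl hne'
  · exact Or.inl (logstar_powLL _)
  · exact Or.inr (two_powLL_logstar.trans (logstar_powLL _))
  · exact Or.inr (logstar_powLL _)
  · rcases lt_trichotomy m m' with h | h | h
    · exact Or.inr (iter_powLL h)
    · exact absurd (by rw [h]) hne'
    · exact Or.inl (iter_powLL h)

theorem exists_family : ∃ C : Set (ℕ → ℕ), (∀ a ∈ C, Nice a) ∧
    (fun _ => 2) ∈ C ∧ logstar ∈ C ∧ (∀ m, plog^[m] ∈ C) ∧
    (∀ a ∈ C, ∀ b ∈ C, a ≠ b → PowLL a b ∨ PowLL b a) ∧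
    (∀ a ∈ C, ∀ b ∈ C, PowLL a b → ∃ c ∈ C, PowLL a c ∧ PowLL c b) := by
  obtain ⟨M, hM, hsub⟩ := base_chain.exists_maxChain
  have hch : ∀ x ∈ M, ∀ y ∈ M, x ≠ y → PowLL x.1 y.1 ∨ PowLL y.1 x.1 := by
    intro x hx y hy hne
    rcases hM.1 hx hy hne with h | h
    · exact h
    · exact h.symm
  refine ⟨Subtype.val '' M, ?_, ⟨⟨_, two_nice⟩, hsub (Or.inl rfl), rfl⟩,
    ⟨⟨_, logstar_nice⟩, hsub (Or.inr (Or.inl rfl)), rfl⟩,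
    fun m => ⟨⟨_, iter_nice m⟩, hsub (Or.inr (Or.inr ⟨m, rfl⟩)), rfl⟩, ?_, ?_⟩
  · rintro _ ⟨x, _, rfl⟩
    exact x.2
  · rintro _ ⟨x, hx, rfl⟩ _ ⟨y, hy, rfl⟩ hne
    exact hch x hx y hy fun h => hne (by rw [h])
  · rintro _ ⟨x, hx, rfl⟩ _ ⟨y, hy, rfl⟩ hxy
    by_contra hcon
    obtain ⟨c, hc, hxc, hcy⟩ := interp x.2 y.2 hxy
    have hins : IsChain NiceR (insert ⟨c, hc⟩ M) := by
      apply hM.1.insert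
      intro z hz _
      left
      simp only [NiceR]
      by_cases hzx : z = x
      · rw [hzx]; exact Or.inr hxc
      by_cases hzy : z = y
      · rw [hzy]; exact Or.inl hcy
      rcases hch z hz x hx hzx with h | h
      · exact Or.inr (h.trans hxc)
      rcases hch z hz y hy hzy with h' | h'
      · exact absurd ⟨z.1, ⟨z, hz, rfl⟩, h, h'⟩ hcon
      · exact Or.inl (hcy.trans h')
    have := hM.2 hins (Set.subset_insert _ _)
    have hmem : (⟨c, hc⟩ : {α : ℕ → ℕ // Nice α}) ∈ M := by
      rw [this]; exact Set.mem_insert _ _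
    exact hcon ⟨c, ⟨_, hmem, rfl⟩, hxc, hcy⟩

theorem factor_eq {a b : ℕ → ℕ} (h : (fun n => n * a n) = fun n => n * b n) :
    ∀ᶠ n in atTop, a n = b n := by
  filter_upwards [eventually_ge_atTop 1] with n hn
  exact Nat.eq_of_mul_eq_mul_left hn (congrFun h n)

theorem powLL_congr {a a' b b' : ℕ → ℕ} (ha : ∀ᶠ n in atTop, a n = a' n)
    (hb : ∀ᶠ n in atTop, b n = b' n) (h : PowLL a b) : PowLL a' b' := by
  intro k
  filter_upwards [ha, hb, h k] with n h1 h2 h3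
  rw [← h1, ← h2]
  exact h3

theorem stmt16 :
    ∃ U₁ : Set (ℕ → ℕ),
      (∀ β ∈ U₁, IsBound β ∧
        ∃ α : ℕ → ℕ, Monotone α ∧ FCons α ∧
          AEle (fun _ => 2) α ∧ AEle α (fun n => n) ∧ β = fun n => n * α n) ∧
      Tame U₁ ∧
      ((fun n => 2 * n) ∈ U₁ ∧
       (fun n => n * logstar n) ∈ U₁ ∧
       (∀ m : ℕ, 1 ≤ m → (fun n => n * plog^[m] n) ∈ U₁) ∧
       (fun n => n ^ 2) ∈ U₁) ∧
      (∀ β₁ ∈ U₁, ∀ β₂ ∈ U₁, β₁ ≠ β₂ → LtIt β₁ β₂ ∨ LtIt β₂ β₁) ∧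
      (∀ β₁ ∈ U₁, ∀ β₂ ∈ U₁, LtIt β₁ β₂ → ∃ β₃ ∈ U₁, LtIt β₁ β₃ ∧ LtIt β₃ β₂) ∧
      (∀ α₁ α₂ : ℕ → ℕ,
        (fun n => n * α₁ n) ∈ U₁ → (fun n => n * α₂ n) ∈ U₁ →
        (LtIt (fun n => n * α₁ n) (fun n => n * α₂ n) ↔ PowLL α₁ α₂)) := by

  obtain ⟨C, hN, h2, hls, hpl, hch, hdense⟩ := exists_family
  have hlt : ∀ a ∈ C, ∀ b ∈ C, LtIt (fun n => n * a n) (fun n => n * b n) → PowLL a b := by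
    intro a ha b hb h
    by_cases hab : a = b
    · subst hab
      exact absurd h.1 h.2
    rcases hch a ha b hb hab with h' | h'
    · exact h'
    · exact absurd h.1 (ltIt_of_powLL (hN b hb) (hN a ha) h').2
  refine ⟨(fun a : ℕ → ℕ => fun n => n * a n) '' C, ?_, ?_, ⟨?_, ?_, ?_, ?_⟩, ?_, ?_, ?_⟩
  · rintro _ ⟨a, ha, rfl⟩
    have h := hN a ha
    exact ⟨fun n => ⟨h.pos n, h.mono_mul (Nat.le_succ n)⟩,
      a, h.mono, h.fcons, h.two_le, h.le_id, rfl⟩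
  · rintro _ ⟨a, ha, rfl⟩ _ ⟨b, hb, rfl⟩
    by_cases hab : a = b
    · subst hab
      exact Or.inl ⟨1, ratio_one (hN a ha)⟩
    rcases hch a ha b hb hab with h | h
    · exact Or.inl ⟨0, ratio_zero (hN a ha) h⟩
    · exact Or.inr (ratio_atTop (hN b hb) h)
  · exact ⟨_, h2, by funext n; exact mul_comm _ _⟩
  · exact ⟨_, hls, rfl⟩
  · exact fun m _ => ⟨_, hpl m, rfl⟩
  · exact ⟨_, hpl 0, by funext n; simp [pow_two]⟩
  · rintro _ ⟨a, ha, rfl⟩ _ ⟨b, hb, rfl⟩ hne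
    rcases hch a ha b hb (fun h => hne (by rw [h])) with h | h
    · exact Or.inl (ltIt_of_powLL (hN a ha) (hN b hb) h)
    · exact Or.inr (ltIt_of_powLL (hN b hb) (hN a ha) h)
  · rintro _ ⟨a, ha, rfl⟩ _ ⟨b, hb, rfl⟩ h
    obtain ⟨c, hc, h1, h3⟩ := hdense a ha b hb (hlt a ha b hb h)
    exact ⟨_, ⟨c, hc, rfl⟩, ltIt_of_powLL (hN a ha) (hN c hc) h1,
      ltIt_of_powLL (hN c hc) (hN b hb) h3⟩
  · rintro a' b' ⟨a, ha, hae⟩ ⟨b, hb, hbe⟩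
    simp only at hae hbe
    have e1 := factor_eq hae
    have e2 := factor_eq hbe
    rw [← hae, ← hbe]
    constructor
    · intro h
      exact powLL_congr e1 e2 (hlt a ha b hb h)
    · intro h
      exact ltIt_of_powLL (hN a ha) (hN b hb)
        (powLL_congr (e1.mono fun _ h => h.symm) (e2.mono fun _ h => h.symm) h)
end

section
/- Let U be a set of bound functions which is it-complete (for every β ∈ U there is a subset B̃ ⊆ U with B̃ ≡ₐₑ It(β)) and it-tame (any β₁, β₂ ∈ U satisfy β₁ ≤it β₂ or β₂ ≤it β₁). Then every subset B ⊆ U which is closed under ≤it within U (i.e. β ∈ B whenever β ∈ U and β ≤it β' for some β' ∈ B) and contains a bound β₀ ∈ B with (n ↦ 2n) ≤ₐₑ β₀ satisfies the composition condition: for all β, β' ∈ B there is β'' ∈ B with β + β'∘β ≤ₐₑ β''. -/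
open Filter

theorem IsBound.mono' {β : ℕ → ℕ} (h : IsBound β) : Monotone β :=
  monotone_nat_of_le_succ fun n => (h n).2

theorem aele_comp {f g f' g' : ℕ → ℕ} (hf : IsBound f) (hg' : Monotone g')
    (h : AEle f g) (h' : AEle f' g') : AEle (fun n => f' (f n)) (fun n => g' (g n)) := by
  have ht : Tendsto f atTop atTop := tendsto_atTop_mono (fun n => (hf n).1) tendsto_id
  have h2 := ht.eventually h'
  unfold AEle at h ⊢
  filter_upwards [h, h2] with n h1 h2
  exact h2.trans (hg' h1)

theorem leIt_of {f γ : ℕ → ℕ} (hf : IsBound f) (hγ : IsBound γ) {m : ℕ} (hm : 1 ≤ m)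
    (h : AEle f γ^[m]) : LeIt f γ := by
  rintro _ ⟨k, hk, rfl⟩
  refine ⟨γ^[k * m], ⟨k * m, Nat.mul_pos hk hm, rfl⟩, ?_⟩
  clear hk
  induction k with
  | zero => exact Eventually.of_forall fun n => by simp
  | succ k ih =>
    have := aele_comp hf (hγ.mono'.iterate (k * m)) h ih
    have e : γ^[(k + 1) * m] = fun n => γ^[k * m] (γ^[m] n) := by
      funext n
      rw [Nat.add_mul, Nat.one_mul, Function.iterate_add_apply]
    rw [e]
    exact this

theorem of_leIt {f γ : ℕ → ℕ} (h : LeIt f γ) : ∃ m, 1 ≤ m ∧ AEle f γ^[m] := by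
  obtain ⟨_, ⟨m, hm, rfl⟩, h⟩ := h f ⟨1, le_rfl, rfl⟩
  exact ⟨m, hm, h⟩

theorem LeIt.trans' {a b c : ℕ → ℕ} (h : LeIt a b) (h' : LeIt b c) : LeIt a c := by
  intro x hx
  obtain ⟨y, hy, hxy⟩ := h x hx
  obtain ⟨z, hz, hyz⟩ := h' y hy
  refine ⟨z, hz, ?_⟩
  unfold AEle at *
  filter_upwards [hxy, hyz] with n h1 h2
  exact h1.trans h2

theorem LeIt.refl' (a : ℕ → ℕ) : LeIt a a :=
  fun x hx => ⟨x, hx, Eventually.of_forall fun _ => le_rfl⟩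

theorem stmt18 (U : Set (ℕ → ℕ)) (hU : ∀ β ∈ U, IsBound β)
    (hcomplete : ∀ β ∈ U, ∃ B' : Set (ℕ → ℕ), B' ⊆ U ∧ SetEquivAE B' (It β))
    (htame : ∀ β₁ ∈ U, ∀ β₂ ∈ U, LeIt β₁ β₂ ∨ LeIt β₂ β₁)
    (B : Set (ℕ → ℕ)) (hBU : B ⊆ U)
    (hclosed : ∀ β ∈ U, (∃ β' ∈ B, LeIt β β') → β ∈ B)
    (β₀ : ℕ → ℕ) (hβ₀ : β₀ ∈ B) (h2n : AEle (fun n => 2 * n) β₀) :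
    CompCond B := by
  intro β hβ β' hβ'
  have hmax : ∀ a ∈ B, ∀ b ∈ B, ∃ c ∈ B, LeIt a c ∧ LeIt b c := by
    intro a ha b hb
    rcases htame a (hBU ha) b (hBU hb) with h | h
    · exact ⟨b, hb, h, LeIt.refl' b⟩
    · exact ⟨a, ha, LeIt.refl' a, h⟩
  obtain ⟨δ, hδ, h1, h2⟩ := hmax β hβ β' hβ'
  obtain ⟨γ, hγ, h3, h4⟩ := hmax δ hδ β₀ hβ₀
  have bγ := hU γ (hBU hγ)
  have bβ := hU β (hBU hβ)
  have bβ' := hU β' (hBU hβ')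
  obtain ⟨p, hp, hp'⟩ := of_leIt (h1.trans' h3)
  obtain ⟨q, hq, hq'⟩ := of_leIt (h2.trans' h3)
  obtain ⟨r, hr, hr'⟩ := of_leIt h4
  have c1 := aele_comp bβ (bγ.mono'.iterate q) hp' hq'
  have bc : IsBound (fun n => β' (β n)) := fun n =>
    ⟨(bβ n).1.trans (bβ' _).1, bβ'.mono' (bβ n).2⟩
  have h2r : AEle (fun n => 2 * n) γ^[r] := by
    unfold AEle at *
    filter_upwards [h2n, hr'] with n u v
    exact u.trans v
  have c2 := aele_comp bc (bγ.mono'.iterate r) c1 h2r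
  obtain ⟨B', hB'U, e1, e2⟩ := hcomplete γ (hBU hγ)
  obtain ⟨β'', hβ'', hk⟩ := e2 γ^[r + (q + p)] ⟨_, by omega, rfl⟩
  obtain ⟨_, ⟨m, hm, rfl⟩, hm'⟩ := e1 β'' hβ''
  refine ⟨β'', hclosed _ (hB'U hβ'') ⟨γ, hγ, leIt_of (hU _ (hB'U hβ'')) bγ hm hm'⟩, ?_⟩
  unfold AEle at *
  filter_upwards [c2, hk] with n u v
  rw [Function.iterate_add_apply, Function.iterate_add_apply] at v
  have w := (bβ' (β n)).1
  omega
end
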